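/- arXiv:2407.05142 — 7 statements merged into one kernel-verified Lean document; each statement's English description precedes it below -/
import Mathlib

section
/- The function J_BS is continuous on (0, ∞), satisfies J_BS(1) = 0, and J_BS(k) > 0 for every k ∈ (0, ∞) with k ≠ 1. -/
/-- `sinh β / β`, extended by its limiting value `1` at `β = 0`. -/
noncomputable def sinhc (b : ℝ) : ℝ := if b = 0 then 1 else Real.sinh b / b

/-- `sin (2ξ) / (2ξ)`, extended by its limiting value `1` at `ξ = 0`. -/
noncomputable def sinc2 (x : ℝ) : ℝ := if x = 0 then 1 else Real.sin (2 * x) / (2 * x)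

/-- `J` is the Black–Scholes Asian rate function `J_BS`: for `k ≥ 1`,
`J k = β²/2 − β·tanh(β/2)` where `β ≥ 0` solves `sinh β/β = k`, and for `0 < k ≤ 1`,
`J k = 2ξ(tan ξ − ξ)` where `ξ ∈ [0, π/2]` solves `sin(2ξ)/(2ξ) = k`. -/
def IsJBS (J : ℝ → ℝ) : Prop :=
  (∀ k : ℝ, 1 ≤ k → ∀ β : ℝ, 0 ≤ β → sinhc β = k →
      J k = β ^ 2 / 2 - β * Real.tanh (β / 2)) ∧
  (∀ k : ℝ, 0 < k → k ≤ 1 → ∀ ξ : ℝ, ξ ∈ Set.Icc 0 (Real.pi / 2) → sinc2 ξ = k →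
      J k = 2 * ξ * (Real.tan ξ - ξ))

open Set in
/-- If `J ∘ g` is continuous on `s`, where `g` is strictly monotone on `s` and maps the interval `s`
onto the interval `t`, then `J` is continuous on `t`. -/
theorem continuousOn_of_comp_strictMonoOn {s t : Set ℝ} [OrdConnected s] [OrdConnected t]
    {g H J : ℝ → ℝ} (hg : StrictMonoOn g s) (himg : g '' s = t) (hH : ContinuousOn H s)
    (hJ : ∀ x ∈ s, J (g x) = H x) : ContinuousOn J t := by
  subst himg
  have hcont := hH.domRestrict.comp (hg.orderIso g s).symm.continuous
  rw [continuousOn_iff_continuous_domRestrict]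
  convert hcont using 1
  funext y
  obtain ⟨x, rfl⟩ := (hg.orderIso g s).surjective y
  simpa using! hJ x x.2

theorem sinhc_zero : sinhc 0 = 1 := by simp [sinhc]

theorem sinhc_of_ne_zero {b : ℝ} (hb : b ≠ 0) : sinhc b = Real.sinh b / b := by simp [sinhc, hb]

theorem sinhc_eq_dslope : sinhc = dslope Real.sinh 0 := by
  ext
  simp [dslope, Function.update_apply, sinhc, slope, div_eq_inv_mul]

theorem continuous_sinhc : Continuous sinhc := by
  refine continuous_iff_continuousAt.mpr fun x ↦ ?_
  rw [sinhc_eq_dslope]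
  by_cases hx : x = 0
  · subst hx
    exact continuousAt_dslope_same.2 Real.differentiableAt_sinh
  · rw [continuousAt_dslope_of_ne hx]
    exact Real.continuous_sinh.continuousAt

theorem strictConvexOn_sinh : StrictConvexOn ℝ (Set.Ici 0) Real.sinh := by
  refine StrictMonoOn.strictConvexOn_of_deriv (convex_Ici 0) Real.continuous_sinh.continuousOn ?_
  rw [Real.deriv_sinh]
  exact Real.cosh_strictMonoOn.mono interior_subset

theorem strictMonoOn_sinhc : StrictMonoOn sinhc (Set.Ici 0) := by
  intro x hx y hy hxy
  have hy0 : 0 < y := lt_of_le_of_lt hx hxy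
  rw [sinhc_of_ne_zero hy0.ne']
  rcases eq_or_ne x 0 with rfl | hx0
  · rw [sinhc_zero, one_lt_div hy0]
    exact Real.self_lt_sinh_iff.2 hy0
  · rw [sinhc_of_ne_zero hx0]
    simpa using
      strictConvexOn_sinh.secant_strict_mono (a := 0) Set.self_mem_Ici hx hy hx0 hy0.ne' hxy

theorem le_sinhc_two_mul {k : ℝ} (hk : 0 < k) : k ≤ sinhc (2 * k) := by
  rw [sinhc_of_ne_zero (by positivity), le_div_iff₀ (by positivity), Real.sinh_two_mul]
  have h₁ : k ≤ Real.sinh k := Real.self_le_sinh_iff.2 hk.le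
  have h₂ : k ≤ Real.cosh k := h₁.trans (Real.sinh_lt_cosh k).le
  nlinarith [mul_le_mul h₁ h₂ hk.le (hk.le.trans h₁)]

theorem image_sinhc_Ici : sinhc '' Set.Ici 0 = Set.Ici 1 := by
  apply Set.Subset.antisymm
  · rintro _ ⟨b, hb, rfl⟩
    rw [← sinhc_zero]
    exact strictMonoOn_sinhc.monotoneOn Set.self_mem_Ici hb hb
  · intro k hk
    have hk0 : 0 < k := lt_of_lt_of_le one_pos hk
    obtain ⟨b, hb, rfl⟩ := intermediate_value_Icc (by positivity : 0 ≤ 2 * k)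
      continuous_sinhc.continuousOn ⟨sinhc_zero.trans_le hk, le_sinhc_two_mul hk0⟩
    exact ⟨b, hb.1, rfl⟩

theorem Real.tanh_lt_self {x : ℝ} (hx : 0 < x) : Real.tanh x < x := by
  obtain ⟨c, hc, h⟩ := exists_hasDerivAt_eq_slope Real.sinh Real.cosh hx
    Real.continuous_sinh.continuousOn fun y _ ↦ Real.hasDerivAt_sinh y
  rw [Real.sinh_zero, sub_zero, sub_zero, eq_div_iff hx.ne'] at h
  rw [Real.tanh_eq_sinh_div_cosh, div_lt_iff₀ (Real.cosh_pos x), ← h, mul_comm]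
  exact mul_lt_mul_of_pos_left (Real.cosh_strictMonoOn hc.1.le hx.le hc.2) hx

theorem sinc2_eq_sinc (x : ℝ) : sinc2 x = Real.sinc (2 * x) := by
  simp [sinc2, Real.sinc_apply]

theorem sinc2_zero : sinc2 0 = 1 := by simp [sinc2]

theorem sinc2_neg (x : ℝ) : sinc2 (-x) = sinc2 x := by
  rw [sinc2_eq_sinc, sinc2_eq_sinc, mul_neg, Real.sinc_neg]

theorem continuous_sinc2 : Continuous sinc2 := by
  simp only [funext sinc2_eq_sinc]
  fun_prop

theorem Real.strictAntiOn_sinc : StrictAntiOn Real.sinc (Set.Icc 0 Real.pi) := by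
  intro x hx y hy hxy
  have hy0 : 0 < y := lt_of_le_of_lt hx.1 hxy
  rw [Real.sinc_of_ne_zero hy0.ne']
  rcases eq_or_ne x 0 with rfl | hx0
  · rw [Real.sinc_zero, div_lt_one hy0]
    exact Real.sin_lt hy0
  · rw [Real.sinc_of_ne_zero hx0]
    have := strictConcaveOn_sin_Icc.neg.secant_strict_mono (a := 0)
      ⟨le_rfl, Real.pi_pos.le⟩ hx hy hx0 hy0.ne' hxy
    simpa [neg_div] using this

theorem strictAntiOn_sinc2 : StrictAntiOn sinc2 (Set.Icc 0 (Real.pi / 2)) := by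
  intro x hx y hy hxy
  rw [sinc2_eq_sinc, sinc2_eq_sinc]
  exact Real.strictAntiOn_sinc ⟨by linarith [hx.1], by linarith [hx.2]⟩
    ⟨by linarith [hy.1], by linarith [hy.2]⟩ (by linarith)

theorem sinc2_pi_div_two : sinc2 (Real.pi / 2) = 0 := by
  have : Real.pi / 2 ≠ 0 := by positivity
  simp [sinc2, this, mul_div_cancel₀]

theorem image_sinc2_Ico : sinc2 '' Set.Ico 0 (Real.pi / 2) = Set.Ioc 0 1 := by
  have hpi : 0 ≤ Real.pi / 2 := by positivity
  apply Set.Subset.antisymm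
  · rintro _ ⟨x, hx, rfl⟩
    have hx' : x ∈ Set.Icc 0 (Real.pi / 2) := Set.Ico_subset_Icc_self hx
    exact ⟨sinc2_pi_div_two.symm.trans_lt (strictAntiOn_sinc2 hx' ⟨hpi, le_rfl⟩ hx.2),
      (strictAntiOn_sinc2.antitoneOn ⟨le_rfl, hpi⟩ hx' hx.1).trans_eq sinc2_zero⟩
  · intro k hk
    obtain ⟨x, hx, rfl⟩ := intermediate_value_Icc' hpi continuous_sinc2.continuousOn
      ⟨sinc2_pi_div_two.trans_le hk.1.le, hk.2.trans_eq sinc2_zero.symm⟩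
    refine ⟨x, ⟨hx.1, lt_of_le_of_ne hx.2 ?_⟩, rfl⟩
    rintro rfl
    exact hk.1.ne' sinc2_pi_div_two

theorem strictMonoOn_sinc2 : StrictMonoOn sinc2 (Set.Ioc (-(Real.pi / 2)) 0) := by
  intro x hx y hy hxy
  rw [← sinc2_neg x, ← sinc2_neg y]
  exact strictAntiOn_sinc2 ⟨by linarith [hy.2], by linarith [hy.1]⟩
    ⟨by linarith [hx.2], by linarith [hx.1]⟩ (by linarith)

theorem image_sinc2_Ioc : sinc2 '' Set.Ioc (-(Real.pi / 2)) 0 = Set.Ioc 0 1 := by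
  rw [← image_sinc2_Ico]
  have : Set.Ioc (-(Real.pi / 2)) 0 = Neg.neg '' Set.Ico 0 (Real.pi / 2) := by simp
  rw [this, Set.image_image]
  simp only [sinc2_neg]

namespace IsJBS

variable {J : ℝ → ℝ}

theorem apply_sinhc (hJ : IsJBS J) {b : ℝ} (hb : 0 ≤ b) :
    J (sinhc b) = b ^ 2 / 2 - b * Real.tanh (b / 2) :=
  hJ.1 _ (image_sinhc_Ici.subset ⟨b, hb, rfl⟩) b hb rfl

theorem apply_sinc2 (hJ : IsJBS J) {x : ℝ} (hx : x ∈ Set.Ico 0 (Real.pi / 2)) :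
    J (sinc2 x) = 2 * x * (Real.tan x - x) :=
  have h := image_sinc2_Ico.subset ⟨x, hx, rfl⟩
  hJ.2 _ h.1 h.2 x ⟨hx.1, hx.2.le⟩ rfl

theorem continuousOn_Ici (hJ : IsJBS J) : ContinuousOn J (Set.Ici 1) := by
  refine continuousOn_of_comp_strictMonoOn strictMonoOn_sinhc image_sinhc_Ici
    (Continuous.continuousOn ?_) fun b hb ↦ hJ.apply_sinhc hb
  have htanh : Continuous Real.tanh := by
    simp only [funext Real.tanh_eq_sinh_div_cosh]
    exact Real.continuous_sinh.div Real.continuous_cosh fun x ↦ (Real.cosh_pos x).ne'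
  fun_prop

theorem continuousOn_Ioc (hJ : IsJBS J) : ContinuousOn J (Set.Ioc 0 1) := by
  refine continuousOn_of_comp_strictMonoOn (H := fun x ↦ 2 * x * (Real.tan x - x))
    strictMonoOn_sinc2 image_sinc2_Ioc ?_ fun x hx ↦ ?_
  · have htan : ContinuousOn Real.tan (Set.Ioc (-(Real.pi / 2)) 0) :=
      Real.continuousOn_tan_Ioo.mono fun x hx ↦ ⟨hx.1, hx.2.trans_lt (by positivity)⟩
    fun_prop
  · rw [← sinc2_neg, hJ.apply_sinc2 ⟨by linarith [hx.2], by linarith [hx.1]⟩, Real.tan_neg]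
    ring

theorem continuousOn_Ioi (hJ : IsJBS J) : ContinuousOn J (Set.Ioi 0) := by
  intro k hk
  apply ContinuousAt.continuousWithinAt
  rcases lt_trichotomy k 1 with h | rfl | h
  · exact hJ.continuousOn_Ioc.continuousAt (Ioc_mem_nhds hk h)
  · have hunion := (hJ.continuousOn_Ioc 1 ⟨one_pos, le_rfl⟩).union (hJ.continuousOn_Ici 1 Set.self_mem_Ici)
    rw [Set.Ioc_union_Ici_eq_Ioi one_pos] at hunion
    exact hunion.continuousAt (Ioi_mem_nhds one_pos)
  · exact hJ.continuousOn_Ici.continuousAt (Ici_mem_nhds h)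

theorem apply_one (hJ : IsJBS J) : J 1 = 0 := by
  simpa [sinhc_zero] using hJ.apply_sinhc le_rfl

theorem pos (hJ : IsJBS J) {k : ℝ} (hk : 0 < k) (hk1 : k ≠ 1) : 0 < J k := by
  rcases hk1.lt_or_gt with h | h
  · obtain ⟨x, hx, rfl⟩ := image_sinc2_Ico.superset ⟨hk, h.le⟩
    have hx0 : 0 < x := hx.1.lt_of_ne (by rintro rfl; exact hk1 sinc2_zero)
    rw [hJ.apply_sinc2 hx]
    have := sub_pos.2 (Real.lt_tan hx0 hx.2)
    positivity
  · obtain ⟨b, hb, rfl⟩ := image_sinhc_Ici.superset h.le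
    have hb0 : 0 < b := lt_of_le_of_ne hb (by rintro rfl; exact hk1 sinhc_zero)
    rw [hJ.apply_sinhc hb]
    nlinarith [Real.tanh_lt_self (half_pos hb0)]

end IsJBS

/-- `J_BS` is continuous on `(0, ∞)`, vanishes at `1`, and is strictly positive at
every `k ∈ (0, ∞)` with `k ≠ 1`. -/
theorem jbs_continuous_pos (J : ℝ → ℝ) (hJ : IsJBS J) :
    ContinuousOn J (Set.Ioi 0) ∧ J 1 = 0 ∧
    ∀ k : ℝ, 0 < k → k ≠ 1 → 0 < J k := by
  exact ⟨hJ.continuousOn_Ioi, hJ.apply_one, fun _ ↦ hJ.pos⟩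
end

section
/- As y → 0, y²/(2·J_BS(e^y)) = (1/3)(1 + (1/5)y − (1/84)y² − (17/10500)y³) + O(y⁴); that is, y ↦ (y²/(2·J_BS(e^y)) − 1/3 − y/15 + y²/252 + 17y³/31500)/y⁴ is bounded in a punctured neighborhood of y = 0. -/
open Filter Topology Asymptotics

/-- The entire function `∑ sⁿ / (2n + m)!`; for `m = 0` and `m = 1` it is `cosh √s` and
`sinh √s / √s`. -/
noncomputable def factorialSeries (m : ℕ) (s : ℝ) : ℝ :=
  ∑' n : ℕ, s ^ n / ((2 * n + m).factorial : ℝ)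

lemma abs_factorialSeries_term_le (m n : ℕ) (s : ℝ) :
    ‖s ^ n / ((2 * n + m).factorial : ℝ)‖ ≤ |s| ^ n / (n.factorial : ℝ) := by
  rw [norm_div, norm_pow, Real.norm_eq_abs, Real.norm_natCast]
  gcongr
  omega

lemma summable_factorialSeries (m : ℕ) (s : ℝ) :
    Summable fun n : ℕ => s ^ n / ((2 * n + m).factorial : ℝ) :=
  Summable.of_norm_bounded (Real.summable_pow_div_factorial |s|)
    fun n => abs_factorialSeries_term_le m n s

lemma factorialSeries_eq_add (m : ℕ) (s : ℝ) :
    factorialSeries m s = 1 / (m.factorial : ℝ) + s * factorialSeries (m + 2) s := by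
  rw [factorialSeries, (summable_factorialSeries m s).tsum_eq_zero_add, factorialSeries,
    ← tsum_mul_left]
  congr 1
  · simp
  · refine tsum_congr fun n => ?_
    rw [show 2 * (n + 1) + m = 2 * n + (m + 2) by ring, pow_succ]
    ring

lemma abs_factorialSeries_le (m : ℕ) {s : ℝ} (hs : |s| ≤ 1) : |factorialSeries m s| ≤ 3 := by
  have h : HasSum (fun n : ℕ => (1 : ℝ) ^ n / (n.factorial : ℝ)) (Real.exp 1) := by
    rw [Real.exp_eq_exp_ℝ]
    exact NormedSpace.expSeries_div_hasSum_exp (1 : ℝ)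
  have h3 : Real.exp 1 ≤ 3 := Real.exp_one_lt_d9.le.trans (by norm_num)
  rw [factorialSeries, ← Real.norm_eq_abs]
  refine le_trans (tsum_of_norm_bounded h fun n => ?_) h3
  refine (abs_factorialSeries_term_le m n s).trans ?_
  gcongr

lemma continuousOn_factorialSeries (m : ℕ) :
    ContinuousOn (factorialSeries m) (Set.Icc (-1) 1) := by
  refine continuousOn_tsum (fun n => by fun_prop) (Real.summable_pow_div_factorial 1) ?_
  intro n s hs
  refine (abs_factorialSeries_term_le m n s).trans ?_
  have := abs_le.2 hs
  gcongr

lemma factorialSeries_zero_sq (b : ℝ) : factorialSeries 0 (b ^ 2) = Real.cosh b := by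
  rw [Real.cosh_eq_tsum, factorialSeries]
  exact tsum_congr fun n => by rw [pow_mul, add_zero]

lemma factorialSeries_zero_neg_sq (x : ℝ) : factorialSeries 0 (-x ^ 2) = Real.cos x := by
  rw [Real.cos_eq_tsum, factorialSeries]
  exact tsum_congr fun n => by rw [neg_pow, pow_mul, add_zero]

lemma mul_factorialSeries_one_sq (b : ℝ) : b * factorialSeries 1 (b ^ 2) = Real.sinh b := by
  rw [Real.sinh_eq_tsum, factorialSeries, ← tsum_mul_left]
  exact tsum_congr fun n => by rw [pow_succ b (2 * n), pow_mul]; ring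

lemma mul_factorialSeries_one_neg_sq (x : ℝ) :
    x * factorialSeries 1 (-x ^ 2) = Real.sin x := by
  rw [Real.sin_eq_tsum, factorialSeries, ← tsum_mul_left]
  exact tsum_congr fun n => by rw [neg_pow, pow_succ x (2 * n), pow_mul]; ring

/-- On the curve `k = factorialSeries 1 s`, both branches of `J_BS` are given by one formula. -/
lemma IsJBS.apply_factorialSeries {J : ℝ → ℝ} (hJ : IsJBS J) {s : ℝ} (hs0 : s ≠ 0)
    (hs : |s| ≤ 1) (hpos : 0 < factorialSeries 1 s) :
    J (factorialSeries 1 s) = s / 2 - (factorialSeries 0 s - 1) / factorialSeries 1 s := by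
  rcases hs0.lt_or_gt with h | h
  · obtain ⟨x, hx, rfl⟩ : ∃ x : ℝ, 0 < x ∧ s = -(2 * x) ^ 2 :=
      ⟨√(-s) / 2, by have := Real.sqrt_pos.2 (neg_pos.2 h); positivity, by
        rw [mul_div_cancel₀ _ two_ne_zero, Real.sq_sqrt (by linarith), neg_neg]⟩
    have hx1 : 2 * x ≤ 1 := by
      rw [abs_neg, abs_of_nonneg (by positivity)] at hs
      nlinarith
    have hsin := mul_factorialSeries_one_neg_sq (2 * x)
    have hk : sinc2 x = factorialSeries 1 (-(2 * x) ^ 2) := by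
      rw [sinc2, if_neg hx.ne', ← hsin]
      field_simp
    have hle : factorialSeries 1 (-(2 * x) ^ 2) ≤ 1 := by
      have := Real.sin_le (show 0 ≤ 2 * x by positivity)
      nlinarith
    rw [hJ.2 _ hpos hle x ⟨hx.le, by linarith [Real.pi_gt_three]⟩ hk,
      factorialSeries_zero_neg_sq, ← hk, sinc2, if_neg hx.ne', Real.tan_eq_sin_div_cos,
      Real.sin_two_mul, Real.cos_two_mul]
    have hsin0 : Real.sin x ≠ 0 :=
      (Real.sin_pos_of_pos_of_lt_pi hx (by linarith [Real.pi_gt_three])).ne'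
    have hc0 : Real.cos x ≠ 0 :=
      (Real.cos_pos_of_le_one (by rw [abs_of_pos hx]; linarith)).ne'
    field_simp
    linear_combination (2 : ℝ) * Real.sin_sq_add_cos_sq x
  · obtain ⟨b, hb, rfl⟩ : ∃ b : ℝ, 0 < b ∧ s = (2 * b) ^ 2 :=
      ⟨√s / 2, by have := Real.sqrt_pos.2 h; positivity, by
        rw [mul_div_cancel₀ _ two_ne_zero, Real.sq_sqrt h.le]⟩
    have hsinh := mul_factorialSeries_one_sq (2 * b)
    have hk : sinhc (2 * b) = factorialSeries 1 ((2 * b) ^ 2) := by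
      rw [sinhc, if_neg (by positivity), ← hsinh]
      field_simp
    have hge : 1 ≤ factorialSeries 1 ((2 * b) ^ 2) := by
      have := Real.self_le_sinh_iff.2 (show 0 ≤ 2 * b by positivity)
      by_contra! hlt
      nlinarith
    rw [hJ.1 _ hge (2 * b) (by positivity) hk, factorialSeries_zero_sq, ← hk, sinhc,
      if_neg (by positivity), mul_div_cancel_left₀ _ two_ne_zero, Real.tanh_eq_sinh_div_cosh,
      Real.sinh_two_mul, Real.cosh_two_mul]
    have hsinh0 : Real.sinh b ≠ 0 := (Real.sinh_pos_iff.2 hb).ne'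
    have hc0 : Real.cosh b ≠ 0 := (Real.cosh_pos b).ne'
    field_simp
    linear_combination Real.cosh_sq b

/-- `f s = a + b s + c s² + d s³ + O(s⁴)` as `s → 0`, `s ≠ 0`. -/
def HasCubicJet (f : ℝ → ℝ) (a b c d : ℝ) : Prop :=
  (fun s => f s - (a + b * s + c * s ^ 2 + d * s ^ 3)) =O[𝓝[≠] 0] fun s : ℝ => s ^ 4

lemma Continuous.isBigO_one_punctured {f : ℝ → ℝ} (hf : Continuous f) :
    f =O[𝓝[≠] 0] fun _ : ℝ => (1 : ℝ) :=
  (hf.tendsto 0 |>.mono_left nhdsWithin_le_nhds).isBigO_one ℝ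

lemma Continuous.isBigO_pow_mul {f : ℝ → ℝ} (hf : Continuous f) :
    (fun s => s ^ 4 * f s) =O[𝓝[≠] 0] fun s : ℝ => s ^ 4 := by
  simpa using (isBigO_refl (fun s : ℝ => s ^ 4) (𝓝[≠] 0)).mul hf.isBigO_one_punctured

namespace HasCubicJet

variable {f g : ℝ → ℝ} {a b c d a₁ b₁ c₁ d₁ : ℝ}

lemma congr_coeff (h : HasCubicJet f a b c d) (ha : a = a₁) (hb : b = b₁) (hc : c = c₁)
    (hd : d = d₁) : HasCubicJet f a₁ b₁ c₁ d₁ := by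
  subst ha hb hc hd
  exact h

lemma const (a : ℝ) : HasCubicJet (fun _ => a) a 0 0 0 := by
  simpa [HasCubicJet] using isBigO_zero _ _

lemma id : HasCubicJet (fun s => s) 0 1 0 0 := by
  simpa [HasCubicJet] using isBigO_zero _ _

lemma add (hf : HasCubicJet f a b c d) (hg : HasCubicJet g a₁ b₁ c₁ d₁) :
    HasCubicJet (fun s => f s + g s) (a + a₁) (b + b₁) (c + c₁) (d + d₁) := by
  refine (IsBigO.add hf hg).congr_left fun s => ?_
  ring

lemma mul (hf : HasCubicJet f a b c d) (hg : HasCubicJet g a₁ b₁ c₁ d₁) :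
    HasCubicJet (fun s => f s * g s) (a * a₁) (a * b₁ + b * a₁) (a * c₁ + b * b₁ + c * a₁)
      (a * d₁ + b * c₁ + c * b₁ + d * a₁) := by
  have hp : Continuous fun s : ℝ => a + b * s + c * s ^ 2 + d * s ^ 3 := by fun_prop
  have hq : Continuous fun s : ℝ => a₁ + b₁ * s + c₁ * s ^ 2 + d₁ * s ^ 3 := by fun_prop
  have hg1 : g =O[𝓝[≠] 0] fun _ : ℝ => (1 : ℝ) := by
    have h4 : Continuous fun s : ℝ => s ^ 4 := by fun_prop
    simpa using (hg.trans h4.isBigO_one_punctured).add hq.isBigO_one_punctured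
  have hr : Continuous fun s : ℝ => b * d₁ + c * c₁ + d * b₁ + (c * d₁ + d * c₁) * s
      + d * d₁ * s ^ 2 := by fun_prop
  have h := ((IsBigO.mul hf hg1).congr_right fun s => mul_one _).add
    (((hp.isBigO_one_punctured.mul hg).congr_right fun s => one_mul _).add hr.isBigO_pow_mul)
  refine h.congr_left fun s => ?_
  ring

lemma neg (hf : HasCubicJet f a b c d) :
    HasCubicJet (fun s => -f s) (-a) (-b) (-c) (-d) := by
  refine (IsBigO.neg_left hf).congr_left fun s => ?_
  ring

lemma tendsto (hf : HasCubicJet f a b c d) : Tendsto f (𝓝[≠] 0) (𝓝 a) := by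
  have h4 : Tendsto (fun s : ℝ => s ^ 4) (𝓝[≠] 0) (𝓝 0) := by
    have : Continuous fun s : ℝ => s ^ 4 := by fun_prop
    simpa using (this.tendsto 0).mono_left nhdsWithin_le_nhds
  have hp : Tendsto (fun s : ℝ => a + b * s + c * s ^ 2 + d * s ^ 3) (𝓝[≠] 0) (𝓝 a) := by
    have : Continuous fun s : ℝ => a + b * s + c * s ^ 2 + d * s ^ 3 := by fun_prop
    simpa using (this.tendsto 0).mono_left nhdsWithin_le_nhds
  simpa using (IsBigO.trans_tendsto hf h4).add hp

end HasCubicJet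

lemma eventually_abs_lt_punctured {r : ℝ} (hr : 0 < r) : ∀ᶠ s : ℝ in 𝓝[≠] 0, |s| < r := by
  refine nhdsWithin_le_nhds ?_
  filter_upwards [Metric.ball_mem_nhds (0 : ℝ) hr] with s hs
  simpa using hs

lemma hasCubicJet_factorialSeries (m : ℕ) :
    HasCubicJet (factorialSeries m) (1 / (m.factorial : ℝ)) (1 / ((m + 2).factorial : ℝ))
      (1 / ((m + 4).factorial : ℝ)) (1 / ((m + 6).factorial : ℝ)) := by
  refine IsBigO.of_bound 3 ?_
  filter_upwards [eventually_abs_lt_punctured one_pos] with s hs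
  rw [factorialSeries_eq_add m, factorialSeries_eq_add (m + 2), factorialSeries_eq_add (m + 2 + 2),
    factorialSeries_eq_add (m + 2 + 2 + 2)]
  have h := abs_factorialSeries_le (m + 2 + 2 + 2 + 2) hs.le
  calc _ = ‖factorialSeries (m + 2 + 2 + 2 + 2) s * s ^ 4‖ := by congr 1; ring
    _ ≤ _ := by rw [norm_mul, Real.norm_eq_abs]; gcongr

/-- The quotient `log (sinh √s / √s) / s`. -/
noncomputable def logSinhcQuotient (s : ℝ) : ℝ := Real.log (factorialSeries 1 s) / s

lemma factorialSeries_one_eq (s : ℝ) : factorialSeries 1 s = 1 + s * factorialSeries 3 s := by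
  simpa using factorialSeries_eq_add 1 s

lemma factorialSeries_zero_eq (s : ℝ) :
    factorialSeries 0 s = 1 + s / 2 + s ^ 2 * factorialSeries 4 s := by
  rw [factorialSeries_eq_add, factorialSeries_eq_add (0 + 2)]
  norm_num [Nat.factorial]
  ring

lemma hasCubicJet_logSinhcQuotient :
    HasCubicJet logSinhcQuotient (1 / 6) (-1 / 180) (1 / 2835) (-1 / 37800) := by
  set v := factorialSeries 3 with hv
  have jv := hasCubicJet_factorialSeries 3
  have ju := (HasCubicJet.id.mul jv).neg
  have js := ((HasCubicJet.const 1).add (((HasCubicJet.const (1 / 2)).mul ju).add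
    (((HasCubicJet.const (1 / 3)).mul (ju.mul ju)).add
      ((HasCubicJet.const (1 / 4)).mul (ju.mul (ju.mul ju))))))
  have jp := jv.mul js
  have hrem : HasCubicJet (fun s => logSinhcQuotient s - v s * (1 + (1 / 2 * (-(s * v s))
      + (1 / 3 * (-(s * v s) * -(s * v s)) + 1 / 4 * (-(s * v s) * (-(s * v s) * -(s * v s)))))))
      0 0 0 0 := by
    refine IsBigO.of_bound (2 * 3 ^ 5) ?_
    filter_upwards [eventually_abs_lt_punctured (show (0 : ℝ) < 1 / 6 by norm_num),
      self_mem_nhdsWithin] with s hs hs0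
    replace hs0 : s ≠ 0 := hs0
    have hvs : |v s| ≤ 3 := abs_factorialSeries_le 3 (by linarith)
    have hu : |-(s * v s)| ≤ 1 / 2 := by
      rw [abs_neg, abs_mul]
      nlinarith [abs_nonneg s, abs_nonneg (v s)]
    have h := Real.abs_log_sub_add_sum_range_le (show |-(s * v s)| < 1 by linarith) 4
    rw [sub_neg_eq_add, ← factorialSeries_one_eq] at h
    have hmul : |s| * ‖logSinhcQuotient s - v s * (1 + (1 / 2 * (-(s * v s))
        + (1 / 3 * (-(s * v s) * -(s * v s)) + 1 / 4 * (-(s * v s) * (-(s * v s) * -(s * v s))))))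
        - (0 + 0 * s + 0 * s ^ 2 + 0 * s ^ 3)‖ ≤ |s| * (2 * 3 ^ 5 * ‖s ^ 4‖) := by
      rw [Real.norm_eq_abs, ← abs_mul]
      calc _ = |(∑ i ∈ Finset.range 4, (-(s * v s)) ^ (i + 1) / ((i : ℝ) + 1))
            + Real.log (factorialSeries 1 s)| := by
            congr 1
            simp only [Finset.sum_range_succ, Finset.sum_range_zero, logSinhcQuotient]
            field_simp
            push_cast
            ring
        _ ≤ _ := h
        _ ≤ |-(s * v s)| ^ 5 * 2 := by
            rw [div_eq_mul_inv]
            gcongr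
            exact inv_le_of_inv_le₀ two_pos (by linarith)
        _ = |s| * (2 * |v s| ^ 5 * ‖s ^ 4‖) := by
            rw [abs_neg, abs_mul, Real.norm_eq_abs, abs_pow]
            ring
        _ ≤ _ := by gcongr
    exact le_of_mul_le_mul_left hmul (abs_pos.2 hs0)
  have h := jp.add hrem
  simp only [← hv, add_sub_cancel] at h
  refine h.congr_coeff ?_ ?_ ?_ ?_ <;> norm_num [Nat.factorial]

lemma hasCubicJet_rateDefect :
    HasCubicJet (fun s => (1 + s * factorialSeries 3 s) * (logSinhcQuotient s * logSinhcQuotient s)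
      + -((factorialSeries 3 s + -(2 * factorialSeries 4 s)) *
        (1 / 3 + s * logSinhcQuotient s * (1 / 15 + s * logSinhcQuotient s *
          (-1 / 252 + -17 / 31500 * (s * logSinhcQuotient s)))))) 0 0 0 0 := by
  have jw := hasCubicJet_logSinhcQuotient
  have jv := hasCubicJet_factorialSeries 3
  have jq := hasCubicJet_factorialSeries 4
  have jy := HasCubicJet.id.mul jw
  have j := (((HasCubicJet.const 1).add (HasCubicJet.id.mul jv)).mul (jw.mul jw)).add
    ((jv.add ((HasCubicJet.const 2).mul jq).neg).mul ((HasCubicJet.const (1 / 3)).add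
      (jy.mul ((HasCubicJet.const (1 / 15)).add (jy.mul ((HasCubicJet.const (-1 / 252)).add
        ((HasCubicJet.const (-17 / 31500)).mul jy))))))).neg
  refine j.congr_coeff ?_ ?_ ?_ ?_ <;> norm_num [Nat.factorial]

/-- Small-`y` expansion
`y²/(2 J_BS(e^y)) = (1/3)(1 + y/5 − y²/84 − 17y³/10500) + O(y⁴)`. -/
theorem jbs_variance_taylor (J : ℝ → ℝ) (hJ : IsJBS J) :
    ∃ C > (0:ℝ), ∃ δ > (0:ℝ), ∀ y : ℝ, y ≠ 0 → |y| < δ →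
      |y ^ 2 / (2 * J (Real.exp y)) - 1/3 - y/15 + y ^ 2/252 + 17 * y ^ 3/31500|
        ≤ C * |y| ^ 4 := by
  have hV := ((hasCubicJet_factorialSeries 3).add
    ((HasCubicJet.const 2).mul (hasCubicJet_factorialSeries 4)).neg).tendsto
  obtain ⟨K, hK, hD⟩ := hasCubicJet_rateDefect.exists_pos
  have hev := (hD.bound.and ((hV.eventually_const_lt (u := 1 / 24)
    (by norm_num [Nat.factorial])).and
    ((hasCubicJet_logSinhcQuotient.tendsto.eventually_const_lt (u := 1 / 12) (by norm_num)).and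
    ((hasCubicJet_factorialSeries 3).tendsto.eventually_const_lt (u := 0)
      (by norm_num [Nat.factorial])))))
  rw [eventually_nhdsWithin_iff, Metric.eventually_nhds_iff] at hev
  obtain ⟨ε, hε, hev⟩ := hev
  set r : ℝ := min (ε / 2) (1 / 6) with hr
  have hr0 : 0 < r := by positivity
  have hrε : r < ε := (min_le_left _ _).trans_lt (by linarith)
  have hr6 : r ≤ 1 / 6 := min_le_right _ _
  have hpos : ∀ s : ℝ, |s| ≤ r → 0 < factorialSeries 1 s := by
    intro s hs
    have h3 := abs_factorialSeries_le 3 (show |s| ≤ 1 by linarith)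
    have : |s * factorialSeries 3 s| ≤ 1 / 2 := by
      rw [abs_mul]
      nlinarith [abs_nonneg s, abs_nonneg (factorialSeries 3 s)]
    rw [factorialSeries_one_eq]
    linarith [(abs_le.1 this).1]
  have hv : ∀ s : ℝ, |s| ≤ r → s ≠ 0 → 0 < factorialSeries 3 s := fun s hs hs0 =>
    (hev (by simpa using hs.trans_lt hrε) hs0).2.2.2
  have hright : 1 < factorialSeries 1 r := by
    have := hv r (abs_of_pos hr0).le hr0.ne'
    rw [factorialSeries_one_eq]
    linarith [mul_pos hr0 this]
  have hleft : factorialSeries 1 (-r) < 1 := by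
    have := hv (-r) (by rw [abs_neg, abs_of_pos hr0]) (neg_ne_zero.2 hr0.ne')
    rw [factorialSeries_one_eq]
    linarith [mul_pos hr0 this]
  have hleft0 := hpos (-r) (by rw [abs_neg, abs_of_pos hr0])
  refine ⟨24 * K * 12 ^ 4, by positivity,
    min (Real.log (factorialSeries 1 r)) (-Real.log (factorialSeries 1 (-r))),
    lt_min (Real.log_pos hright) (neg_pos.2 (Real.log_neg hleft0 hleft)), ?_⟩
  intro y hy0 hy
  have hy1 := (le_abs_self y).trans (hy.le.trans (min_le_left _ _))
  have hy2 := (neg_le_abs y).trans (hy.le.trans (min_le_right _ _))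
  obtain ⟨s, hs, hsy⟩ : Real.exp y ∈ factorialSeries 1 '' Set.Icc (-r) r := by
    refine intermediate_value_Icc (by linarith)
      ((continuousOn_factorialSeries 1).mono (Set.Icc_subset_Icc (by linarith) (by linarith)))
      ⟨?_, ?_⟩
    · rw [← Real.log_le_iff_le_exp hleft0]
      linarith
    · rwa [← Real.le_log_iff_exp_le (by linarith)]
  replace hs : |s| ≤ r := abs_le.2 hs
  have hs0 : s ≠ 0 := by
    rintro rfl
    rw [factorialSeries_one_eq, zero_mul, add_zero, eq_comm, Real.exp_eq_one_iff] at hsy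
    exact hy0 hsy
  obtain ⟨hDs, hVs, hws, -⟩ := hev (by simpa using hs.trans_lt hrε) hs0
  have hyw : y = s * logSinhcQuotient s := by
    rw [logSinhcQuotient, hsy, Real.log_exp, mul_div_cancel₀ _ hs0]
  have hSpos := hpos s hs
  rw [← hsy, hJ.apply_factorialSeries hs0 (by linarith) hSpos, factorialSeries_zero_eq, hyw]
  rw [factorialSeries_one_eq] at hSpos ⊢
  set w := logSinhcQuotient s
  set v := factorialSeries 3 s
  set q := factorialSeries 4 s
  have hV0 : v + -(2 * q) ≠ 0 := by linarith
  have hJs : s / 2 - (1 + s / 2 + s ^ 2 * q - 1) / (1 + s * v)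
      = s ^ 2 * (v + -(2 * q)) / (2 * (1 + s * v)) := by
    field_simp
    ring
  have hE : (s * w) ^ 2 / (2 * (s / 2 - (1 + s / 2 + s ^ 2 * q - 1) / (1 + s * v))) - 1 / 3
      - s * w / 15 + (s * w) ^ 2 / 252 + 17 * (s * w) ^ 3 / 31500
      = ((1 + s * v) * (w * w) + -((v + -(2 * q)) * (1 / 3 + s * w * (1 / 15 + s * w *
        (-1 / 252 + -17 / 31500 * (s * w)))))
        - (0 + 0 * s + 0 * s ^ 2 + 0 * s ^ 3)) / (v + -(2 * q)) := by
    rw [hJs]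
    field_simp
    ring
  rw [hE, abs_div, abs_of_pos (show 0 < v + -(2 * q) by linarith), div_le_iff₀ (by linarith)]
  have hsw : |s| ≤ 12 * |s * w| := by
    rw [abs_mul, abs_of_pos (show 0 < w by linarith)]
    nlinarith [abs_nonneg s]
  calc _ ≤ K * ‖s ^ 4‖ := hDs
    _ = K * |s| ^ 4 := by rw [norm_pow, Real.norm_eq_abs]
    _ ≤ K * (12 * |s * w|) ^ 4 := by gcongr
    _ = 24 * K * 12 ^ 4 * |s * w| ^ 4 * (1 / 24) := by ring
    _ ≤ _ := by gcongr
end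

section
/- Let ε ∈ [0,1) and let f, g : (0,∞) → [0,∞) be measurable functions such that ∫₀^∞ f(a)·(da/a) = 1, n := ∫₀^∞ g(a)·(da/a) satisfies 0 < n < ∞, and |f(a) − g(a)| ≤ ε·g(a) for all a > 0. Set f₀(a) := g(a)/n. Then for every a > 0: −(2ε/(1+ε))·f₀(a) ≤ f(a) − f₀(a) ≤ (2ε/(1−ε))·f₀(a). -/
open MeasureTheory in
/-- Error bound for the normalized approximation: if `f` integrates to `1` against
`da/a` on `(0,∞)`, `n = ∫ g(a) da/a ∈ (0,∞)`, and `|f − g| ≤ ε·g` pointwise with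
`0 ≤ ε < 1`, then `f₀ := g/n` satisfies
`−(2ε/(1+ε))·f₀ ≤ f − f₀ ≤ (2ε/(1−ε))·f₀` on `(0,∞)`. -/
theorem normalized_density_error_bound (ε : ℝ) (hε0 : 0 ≤ ε) (hε1 : ε < 1)
    (f g : ℝ → ℝ) (hfm : Measurable f) (hgm : Measurable g)
    (hf0 : ∀ a : ℝ, 0 < a → 0 ≤ f a) (hg0 : ∀ a : ℝ, 0 < a → 0 ≤ g a)
    (hgi : IntegrableOn (fun a => g a / a) (Set.Ioi 0))
    (hfint : ∫ a in Set.Ioi (0:ℝ), f a / a = 1)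
    (n : ℝ) (hn : n = ∫ a in Set.Ioi (0:ℝ), g a / a) (hn0 : 0 < n)
    (hfg : ∀ a : ℝ, 0 < a → |f a - g a| ≤ ε * g a) :
    ∀ a : ℝ, 0 < a →
      -(2 * ε / (1 + ε)) * (g a / n) ≤ f a - g a / n ∧
      f a - g a / n ≤ 2 * ε / (1 - ε) * (g a / n) := by
  have hfi : IntegrableOn (fun a => f a / a) (Set.Ioi 0) := by
    by_contra h
    rw [integral_undef h] at hfint
    exact zero_ne_one hfint
  have h_upper : 1 ≤ (1 + ε) * n := by
    rw [hn, ← integral_const_mul]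
    refine hfint.symm.trans_le <|
      setIntegral_mono_on hfi (hgi.const_mul _) measurableSet_Ioi fun a ha => ?_
    rw [← mul_div_assoc]
    exact div_le_div_of_nonneg_right (by linarith [(abs_le.1 (hfg a ha)).2]) (le_of_lt ha)
  have h_lower : (1 - ε) * n ≤ 1 := by
    rw [hn, ← integral_const_mul]
    refine le_of_le_of_eq
      (setIntegral_mono_on (hgi.const_mul _) hfi measurableSet_Ioi fun a ha => ?_) hfint
    rw [← mul_div_assoc]
    exact div_le_div_of_nonneg_right (by linarith [(abs_le.1 (hfg a ha)).1]) (le_of_lt ha)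
  intro a ha
  obtain ⟨h₁, h₂⟩ := abs_le.1 (hfg a ha)
  have h_scale : 0 ≤ g a / n := div_nonneg (hg0 a ha) hn0.le
  have hg : g a = n * (g a / n) := by field_simp
  have hpos : 0 < 1 - ε := by linarith
  constructor
  · have h_ratio : 1 / (1 + ε) ≤ n := by
      rw [div_le_iff₀ (by linarith)]
      linarith
    calc -(2 * ε / (1 + ε)) * (g a / n)
        = (1 - ε) * (1 / (1 + ε) * (g a / n)) - g a / n := by
          field_simp
          ring
      _ ≤ (1 - ε) * (n * (g a / n)) - g a / n := by gcongr
      _ ≤ f a - g a / n := by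
          rw [← hg]
          linarith
  · have h_ratio : n ≤ 1 / (1 - ε) := by
      rw [le_div_iff₀ hpos]
      linarith
    calc f a - g a / n
        ≤ (1 + ε) * (n * (g a / n)) - g a / n := by
          rw [← hg]
          linarith
      _ ≤ (1 + ε) * (1 / (1 - ε) * (g a / n)) - g a / n := by gcongr
      _ = 2 * ε / (1 - ε) * (g a / n) := by
          field_simp
          ring
end

section
/- Let ε ∈ [0,1) and let f, g : (0,∞) → [0,∞) be measurable with ∫₀^∞ f(a)·(da/a) = 1, n := ∫₀^∞ g(a)·(da/a) ∈ (0,∞), and |f(a) − g(a)| ≤ ε·g(a) for all a > 0; set f₀ := g/n. Fix k > 0 and define c := ∫₀^∞ (a − k)⁺·f(a)·(da/a) and c₀ := ∫₀^∞ (a − k)⁺·f₀(a)·(da/a), assumed finite. Then −(2ε/(1+ε))·c₀ ≤ c − c₀ ≤ (2ε/(1−ε))·c₀. -/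
open MeasureTheory in
/-- A pointwise relative error bound on a set carries over to the integrals. -/
lemma setIntegral_bounds_of_relative_error {α : Type*} [MeasurableSpace α] {μ : Measure α}
    {s : Set α} (hs : MeasurableSet s) {F G : α → ℝ} {ε : ℝ}
    (hF : IntegrableOn F s μ) (hG : IntegrableOn G s μ)
    (h : ∀ a ∈ s, |F a - G a| ≤ ε * G a) :
    (1 - ε) * ∫ a in s, G a ∂μ ≤ ∫ a in s, F a ∂μ ∧
      ∫ a in s, F a ∂μ ≤ (1 + ε) * ∫ a in s, G a ∂μ := by
  rw [← integral_const_mul, ← integral_const_mul]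
  constructor
  · refine setIntegral_mono_on (hG.const_mul _) hF hs fun a ha => ?_
    linarith [(abs_le.mp (h a ha)).1]
  · refine setIntegral_mono_on hF (hG.const_mul _) hs fun a ha => ?_
    linarith [(abs_le.mp (h a ha)).2]

open MeasureTheory in
/-- Error bound for approximate call prices: under the hypotheses of the density
error bound, the call prices `c = ∫ (a−k)⁺ f(a) da/a` and
`c₀ = ∫ (a−k)⁺ (g(a)/n) da/a` (assumed finite) satisfy
`−(2ε/(1+ε))·c₀ ≤ c − c₀ ≤ (2ε/(1−ε))·c₀`. -/
theorem call_price_error_bound (ε : ℝ) (hε0 : 0 ≤ ε) (hε1 : ε < 1)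
    (f g : ℝ → ℝ) (hfm : Measurable f) (hgm : Measurable g)
    (hf0 : ∀ a : ℝ, 0 < a → 0 ≤ f a) (hg0 : ∀ a : ℝ, 0 < a → 0 ≤ g a)
    (hgi : IntegrableOn (fun a => g a / a) (Set.Ioi 0))
    (hfint : ∫ a in Set.Ioi (0:ℝ), f a / a = 1)
    (n : ℝ) (hn : n = ∫ a in Set.Ioi (0:ℝ), g a / a) (hn0 : 0 < n)
    (hfg : ∀ a : ℝ, 0 < a → |f a - g a| ≤ ε * g a)
    (k : ℝ) (hk : 0 < k)
    (hci : IntegrableOn (fun a => max (a - k) 0 * f a / a) (Set.Ioi 0))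
    (hc0i : IntegrableOn (fun a => max (a - k) 0 * (g a / n) / a) (Set.Ioi 0))
    (c c₀ : ℝ) (hc : c = ∫ a in Set.Ioi (0:ℝ), max (a - k) 0 * f a / a)
    (hc₀ : c₀ = ∫ a in Set.Ioi (0:ℝ), max (a - k) 0 * (g a / n) / a) :
    -(2 * ε / (1 + ε)) * c₀ ≤ c - c₀ ∧ c - c₀ ≤ 2 * ε / (1 - ε) * c₀ := by
  have hfi : IntegrableOn (fun a => f a / a) (Set.Ioi 0) :=
    Integrable.of_integral_ne_zero (by rw [hfint]; exact one_ne_zero)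
  have weighted : ∀ a : ℝ, 0 < a → ∀ w : ℝ, 0 ≤ w →
      |w * f a / a - w * g a / a| ≤ ε * (w * g a / a) := by
    intro a ha w hw
    have e : w * f a / a - w * g a / a = w / a * (f a - g a) := by ring
    rw [e, abs_mul, abs_of_nonneg (div_nonneg hw ha.le)]
    calc w / a * |f a - g a| ≤ w / a * (ε * g a) :=
          mul_le_mul_of_nonneg_left (hfg a ha) (div_nonneg hw ha.le)
      _ = ε * (w * g a / a) := by ring
  have scale : (fun a => max (a - k) 0 * g a / a)
      = fun a => n * (max (a - k) 0 * (g a / n) / a) := by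
    funext a
    field_simp
  have hGi : IntegrableOn (fun a => max (a - k) 0 * g a / a) (Set.Ioi 0) := by
    rw [scale]
    exact hc0i.const_mul n
  have hGint : ∫ a in Set.Ioi (0:ℝ), max (a - k) 0 * g a / a = n * c₀ := by
    rw [scale, integral_const_mul, ← hc₀]
  obtain ⟨mass_lower, mass_upper⟩ :=
    setIntegral_bounds_of_relative_error measurableSet_Ioi hfi hgi
      (fun a ha => by simpa using weighted a ha 1 zero_le_one)
  obtain ⟨price_lower, price_upper⟩ :=
    setIntegral_bounds_of_relative_error measurableSet_Ioi hci hGi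
      (fun a ha => weighted a ha _ (le_max_right _ _))
  rw [hfint, ← hn] at mass_lower mass_upper
  rw [hGint, ← hc] at price_lower price_upper
  have hc₀_nonneg : 0 ≤ c₀ := by
    rw [hc₀]
    refine setIntegral_nonneg measurableSet_Ioi fun a ha => ?_
    exact div_nonneg (mul_nonneg (le_max_right _ _) (div_nonneg (hg0 a ha) hn0.le)) (le_of_lt ha)
  have hp : 0 < 1 + ε := by linarith
  have hm : 0 < 1 - ε := by linarith
  constructor
  · have e : -(2 * ε / (1 + ε)) * c₀ = (1 - ε) * c₀ / (1 + ε) - c₀ := by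
      field_simp
      ring
    rw [e, sub_le_sub_iff_right, div_le_iff₀ hp]
    nlinarith [mul_le_mul_of_nonneg_left mass_upper (mul_nonneg hm.le hc₀_nonneg),
      mul_le_mul_of_nonneg_left price_lower hp.le]
  · have e : 2 * ε / (1 - ε) * c₀ = (1 + ε) * c₀ / (1 - ε) - c₀ := by
      field_simp
      ring
    rw [e, sub_le_sub_iff_right, le_div_iff₀ hm]
    nlinarith [mul_le_mul_of_nonneg_left mass_lower (mul_nonneg hp.le hc₀_nonneg),
      mul_le_mul_of_nonneg_left price_upper hm.le]
end

section
/- (Leading-order Laplace asymptotics, Erdélyi.) Let −∞ < a < b ≤ ∞ and f, g : [a,b) → ℝ with: (i) for every δ > 0, inf{f(x) : x ∈ [a+δ, b)} > f(a); (ii) there are constants α, β > 0, a₀ > 0 and b₀ ≠ 0 such that f(x) − f(a) = a₀(x−a)^α·(1 + o(1)) and g(x) = b₀(x−a)^{β−1}·(1 + o(1)) as x → a⁺; (iii) the integral I(λ) := ∫ₐᵇ e^{−λf(x)} g(x) dx converges absolutely for all sufficiently large λ. Then as λ → ∞, I(λ) = Γ(β/α)·(b₀/(α·a₀^{β/α}))·e^{−λf(a)}·λ^{−β/α}·(1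 + o(1)). -/
open MeasureTheory Filter Set in
/-- Local part of Laplace's method after translating the minimum to `0`. -/
theorem tendsto_rpow_mul_setIntegral_exp_neg_mul {φ γ : ℝ → ℝ} {α β a₀ b₀ δ : ℝ}
    (hα : 0 < α) (hβ : 0 < β) (ha₀ : 0 < a₀) (hb₀ : b₀ ≠ 0) (hδ : 0 < δ)
    (hφ : Tendsto (fun u => φ u / (a₀ * u ^ α)) (nhdsWithin 0 (Ioi 0)) (nhds 1))
    (hγ : Tendsto (fun u => γ u / (b₀ * u ^ (β - 1))) (nhdsWithin 0 (Ioi 0)) (nhds 1))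
    (hφle : ∀ u ∈ Ioo 0 δ, a₀ / 2 * u ^ α ≤ φ u)
    (hγle : ∀ u ∈ Ioo 0 δ, |γ u| ≤ 2 * |b₀| * u ^ (β - 1))
    (hint : ∀ᶠ lam : ℝ in atTop,
      IntegrableOn (fun u => Real.exp (-lam * φ u) * γ u) (Ioo 0 δ)) :
    Tendsto (fun lam : ℝ =>
        lam ^ (β / α) * ∫ u in Ioo 0 δ, Real.exp (-lam * φ u) * γ u)
      atTop (nhds (Real.Gamma (β / α) * (b₀ / (α * a₀ ^ (β / α))))) := by
  have hval : ∀ c : ℝ, 0 < c → ∫ t in Ioi (0 : ℝ), t ^ (β - 1) * Real.exp (-c * t ^ α)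
      = c ^ (-(β / α)) * (1 / α) * Real.Gamma (β / α) := by
    intro c hc
    rw [integral_rpow_mul_exp_neg_mul_rpow hα (by linarith) hc]
    simp [neg_div]
  have hbound : IntegrableOn (fun t : ℝ => t ^ (β - 1) * Real.exp (-(a₀ / 2) * t ^ α))
      (Ioi 0) := by
    apply Integrable.of_integral_ne_zero
    rw [hval _ (half_pos ha₀)]
    have := Real.Gamma_pos_of_pos (div_pos hβ hα)
    positivity
  set G : ℝ → ℝ → ℝ := fun lam => (Ioo 0 δ).indicator fun u => Real.exp (-lam * φ u) * γ u
    with hG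
  set h : ℝ → ℝ := fun lam => lam ^ (-(1 / α)) with hh
  have hscale : ∀ lam : ℝ, 0 < lam →
      0 < h lam ∧ lam * h lam ^ α = 1 ∧ lam ^ (β / α) * h lam * h lam ^ (β - 1) = 1 := by
    intro lam hlam
    refine ⟨by positivity, ?_, ?_⟩
    · simp only [hh]
      rw [← Real.rpow_mul hlam.le, neg_mul, one_div_mul_cancel hα.ne', Real.rpow_neg_one,
        mul_inv_cancel₀ hlam.ne']
    · simp only [hh]
      have he : β / α + -(1 / α) + -(1 / α) * (β - 1) = 0 := by ring
      rw [← Real.rpow_mul hlam.le, ← Real.rpow_add hlam, ← Real.rpow_add hlam, he,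
        Real.rpow_zero]
  have hh0 : Tendsto h atTop (nhds 0) := tendsto_rpow_neg_atTop (by positivity)
  have hlim : Tendsto (fun lam : ℝ => ∫ t in Ioi (0 : ℝ),
      lam ^ (β / α) * h lam * G lam (h lam * t)) atTop
      (nhds (∫ t in Ioi (0 : ℝ), b₀ * (t ^ (β - 1) * Real.exp (-a₀ * t ^ α)))) := by
    apply tendsto_integral_filter_of_dominated_convergence
      (fun t => 2 * |b₀| * (t ^ (β - 1) * Real.exp (-(a₀ / 2) * t ^ α)))
    · filter_upwards [hint, eventually_gt_atTop 0] with lam hl hlam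
      have h1 : Integrable (G lam) := (integrable_indicator_iff measurableSet_Ioo).2 hl
      exact ((h1.comp_mul_left' (hscale lam hlam).1.ne').const_mul _).aestronglyMeasurable.restrict
    · filter_upwards [eventually_gt_atTop 0] with lam hlam
      obtain ⟨hp, e1, e2⟩ := hscale lam hlam
      filter_upwards [ae_restrict_mem measurableSet_Ioi] with t (ht : 0 < t)
      by_cases hm : h lam * t ∈ Ioo 0 δ
      · simp only [hG, indicator_of_mem hm]
        rw [Real.norm_eq_abs, abs_mul,
          abs_of_pos (show 0 < lam ^ (β / α) * h lam by positivity), abs_mul, Real.abs_exp]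
        have h1 := hφle _ hm
        have h2 := hγle _ hm
        rw [Real.mul_rpow hp.le ht.le] at h1 h2
        have h3 : -lam * φ (h lam * t) ≤ -(a₀ / 2) * t ^ α := by
          have h4 := mul_le_mul_of_nonneg_left h1 hlam.le
          have h5 : lam * (a₀ / 2 * (h lam ^ α * t ^ α)) = a₀ / 2 * t ^ α := by
            linear_combination (a₀ / 2 * t ^ α) * e1
          linarith
        calc lam ^ (β / α) * h lam * (Real.exp (-lam * φ (h lam * t)) * |γ (h lam * t)|)
            ≤ lam ^ (β / α) * h lam * (Real.exp (-(a₀ / 2) * t ^ α) *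
                (2 * |b₀| * (h lam ^ (β - 1) * t ^ (β - 1)))) := by gcongr
          _ = 2 * |b₀| * (t ^ (β - 1) * Real.exp (-(a₀ / 2) * t ^ α)) := by
            linear_combination (2 * |b₀| * t ^ (β - 1) * Real.exp (-(a₀ / 2) * t ^ α)) * e2
      · simp only [hG, indicator_of_notMem hm, mul_zero, norm_zero]
        positivity
    · exact hbound.const_mul _
    · filter_upwards [ae_restrict_mem measurableSet_Ioi] with t (ht : 0 < t)
      have hz : Tendsto (fun lam => h lam * t) atTop (nhdsWithin 0 (Ioi 0)) := by
        refine tendsto_nhdsWithin_iff.2 ⟨by simpa using hh0.mul_const t, ?_⟩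
        filter_upwards [eventually_gt_atTop 0] with lam hlam
        exact mul_pos (hscale lam hlam).1 ht
      have hA := hφ.comp hz
      have hB := hγ.comp hz
      have hE := ((hB.const_mul (b₀ * t ^ (β - 1))).mul
        ((Real.continuous_exp.tendsto _).comp (hA.const_mul (-a₀ * t ^ α))))
      have hm : ∀ᶠ lam in atTop, h lam * t ∈ Ioo 0 δ := hz (Ioo_mem_nhdsGT hδ)
      convert hE.congr' _ using 2
      · ring_nf
      filter_upwards [hm, eventually_gt_atTop 0] with lam hm hlam
      obtain ⟨hp, e1, e2⟩ := hscale lam hlam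
      simp only [hG, indicator_of_mem hm, Function.comp]
      rw [Real.mul_rpow hp.le ht.le, Real.mul_rpow hp.le ht.le]
      have p1 : 0 < h lam ^ α := by positivity
      have p2 : 0 < h lam ^ (β - 1) := by positivity
      have p3 : 0 < t ^ α := by positivity
      have p4 : 0 < t ^ (β - 1) := by positivity
      have q1 : -a₀ * t ^ α * (φ (h lam * t) / (a₀ * (h lam ^ α * t ^ α)))
          = -lam * φ (h lam * t) := by
        field_simp
        linear_combination φ (h lam * t) * e1
      have q2 : b₀ * t ^ (β - 1) * (γ (h lam * t) / (b₀ * (h lam ^ (β - 1) * t ^ (β - 1))))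
          = lam ^ (β / α) * h lam * γ (h lam * t) := by
        field_simp
        linear_combination -γ (h lam * t) * e2
      rw [q1, q2]
      ring
  rw [integral_const_mul, hval _ ha₀, Real.rpow_neg ha₀.le] at hlim
  convert hlim.congr' _ using 2
  · field_simp
  filter_upwards [eventually_gt_atTop 0] with lam hlam
  have hp := (hscale lam hlam).1
  rw [integral_const_mul]
  have hs : ∫ t in Ioi (0 : ℝ), G lam (h lam * t) = ∫ t, G lam (h lam * t) := by
    apply setIntegral_eq_integral_of_forall_compl_eq_zero
    intro t ht
    apply indicator_of_notMem
    intro hm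
    exact ht (pos_of_mul_pos_right hm.1 hp.le)
  rw [hs, Measure.integral_comp_mul_left, integral_indicator measurableSet_Ioo,
    abs_of_pos (inv_pos.2 hp), smul_eq_mul]
  field_simp

open MeasureTheory Filter Set in
/-- A region on which the phase exceeds a positive constant contributes an exponentially
small amount to a Laplace integral. -/
theorem tendsto_rpow_mul_setIntegral_exp_neg_mul_zero {φ γ : ℝ → ℝ} {T : Set ℝ} {m L : ℝ}
    (s : ℝ) (hT : MeasurableSet T) (hm : 0 < m) (hφ : ∀ x ∈ T, m ≤ φ x)
    (hint : IntegrableOn (fun x => Real.exp (-L * φ x) * γ x) T) :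
    Tendsto (fun lam : ℝ => lam ^ s * ∫ x in T, Real.exp (-lam * φ x) * γ x)
      atTop (nhds 0) := by
  set C := ∫ x in T, ‖Real.exp (-L * φ x) * γ x‖
  have h0 := (tendsto_rpow_mul_exp_neg_mul_atTop_nhds_zero s m hm).mul_const
    (Real.exp (L * m) * C)
  rw [zero_mul] at h0
  refine squeeze_zero_norm' ?_ h0
  filter_upwards [eventually_gt_atTop 0, eventually_ge_atTop L] with lam hlam hL
  rw [norm_mul, Real.norm_of_nonneg (by positivity : 0 ≤ lam ^ s), mul_assoc]
  refine mul_le_mul_of_nonneg_left ?_ (by positivity)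
  rw [← mul_assoc, ← integral_const_mul]
  refine norm_integral_le_of_norm_le (hint.norm.const_mul _) ?_
  filter_upwards [ae_restrict_mem hT] with x hx
  rw [norm_mul, norm_mul, ← mul_assoc, Real.norm_of_nonneg (Real.exp_nonneg _),
    Real.norm_of_nonneg (Real.exp_nonneg _), ← Real.exp_add, ← Real.exp_add]
  gcongr
  nlinarith [mul_nonneg (sub_nonneg.2 hL) (sub_nonneg.2 (hφ x hx))]


open MeasureTheory Filter Set in
/-- Leading-order Laplace asymptotics (Erdélyi): if on `[a, b)` (with `b ≤ ∞`)
the phase `f` has a strict minimum at `a` (in the sense that its infimum on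
`[a+δ, b)` exceeds `f a` for every `δ > 0`), `f x − f a ∼ a₀ (x−a)^α` and
`g x ∼ b₀ (x−a)^{β−1}` as `x → a⁺`, and `I(λ) = ∫ₐᵇ e^{−λ f} g` converges
absolutely for large `λ`, then
`I(λ) = Γ(β/α)·(b₀/(α a₀^{β/α}))·e^{−λ f a}·λ^{−β/α}·(1 + o(1))` as `λ → ∞`. -/
theorem laplace_leading_asymptotics (a : ℝ) (b : EReal) (hab : (a : EReal) < b)
    (f g : ℝ → ℝ) (α β a₀ b₀ : ℝ) (hα : 0 < α) (hβ : 0 < β) (ha₀ : 0 < a₀)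
    (hb₀ : b₀ ≠ 0)
    (hmin : ∀ δ : ℝ, 0 < δ → ∃ m : ℝ, f a < m ∧
      ∀ x : ℝ, a + δ ≤ x → (x : EReal) < b → m ≤ f x)
    (hf : Tendsto (fun x => (f x - f a) / (a₀ * (x - a) ^ α))
      (nhdsWithin a {x : ℝ | a < x ∧ (x : EReal) < b}) (nhds 1))
    (hg : Tendsto (fun x => g x / (b₀ * (x - a) ^ (β - 1)))
      (nhdsWithin a {x : ℝ | a < x ∧ (x : EReal) < b}) (nhds 1))
    (hconv : ∃ Λ : ℝ, ∀ lam : ℝ, Λ ≤ lam →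
      IntegrableOn (fun x => Real.exp (-lam * f x) * g x)
        {x : ℝ | a ≤ x ∧ (x : EReal) < b}) :
    Tendsto (fun lam : ℝ =>
        (∫ x in {x : ℝ | a ≤ x ∧ (x : EReal) < b}, Real.exp (-lam * f x) * g x) /
        (Real.Gamma (β / α) * (b₀ / (α * a₀ ^ (β / α))) * Real.exp (-lam * f a) *
          lam ^ (-(β / α))))
      atTop (nhds 1) := by
  obtain ⟨Λ, hΛ⟩ := hconv
  set S : Set ℝ := {x : ℝ | a ≤ x ∧ (x : EReal) < b} with hS
  have hopen : IsOpen {x : ℝ | (x : EReal) < b} :=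
    isOpen_Iio.preimage continuous_coe_real_ereal
  have hnhds : nhdsWithin a {x : ℝ | a < x ∧ (x : EReal) < b} = nhdsWithin a (Ioi a) :=
    nhdsWithin_inter_of_mem' (mem_nhdsWithin_of_mem_nhds (hopen.mem_nhds hab))
  rw [hnhds] at hf hg
  have htrans : Tendsto (fun u : ℝ => a + u) (nhdsWithin 0 (Ioi 0)) (nhdsWithin a (Ioi a)) := by
    refine tendsto_nhdsWithin_iff.2 ⟨?_, ?_⟩
    · have : Tendsto (fun u : ℝ => a + u) (nhds 0) (nhds (a + 0)) :=
        (continuous_const_add a).tendsto 0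
      rw [add_zero] at this
      exact this.mono_left nhdsWithin_le_nhds
    · filter_upwards [self_mem_nhdsWithin] with u (hu : 0 < u)
      exact lt_add_of_pos_right a hu
  have hφ : Tendsto (fun u => (f (a + u) - f a) / (a₀ * u ^ α)) (nhdsWithin 0 (Ioi 0))
      (nhds 1) := by
    simpa [Function.comp_def] using hf.comp htrans
  have hγ : Tendsto (fun u => g (a + u) / (b₀ * u ^ (β - 1))) (nhdsWithin 0 (Ioi 0))
      (nhds 1) := by
    simpa [Function.comp_def] using hg.comp htrans
  have hlt : ∀ᶠ u : ℝ in nhdsWithin 0 (Ioi 0), ((a + u : ℝ) : EReal) < b :=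
    htrans.eventually (mem_nhdsWithin_of_mem_nhds (hopen.mem_nhds hab))
  have hev : ∀ᶠ u : ℝ in nhdsWithin 0 (Ioi 0), a₀ / 2 * u ^ α ≤ f (a + u) - f a ∧
      |g (a + u)| ≤ 2 * |b₀| * u ^ (β - 1) ∧ ((a + u : ℝ) : EReal) < b := by
    have hγ' := hγ.abs
    rw [abs_one] at hγ'
    filter_upwards [hφ.eventually (lt_mem_nhds (by norm_num : (1 / 2 : ℝ) < 1)),
      hγ'.eventually (gt_mem_nhds (by norm_num : (1 : ℝ) < 2)), hlt,
      self_mem_nhdsWithin] with u h1 h2 h3 (hu : 0 < u)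
    refine ⟨?_, ?_, h3⟩
    · rw [lt_div_iff₀ (by positivity)] at h1
      linarith
    · rw [abs_div, abs_mul, abs_of_pos (Real.rpow_pos_of_pos hu _),
        div_lt_iff₀ (by positivity)] at h2
      linarith
  obtain ⟨δ, hδ, hsub⟩ := mem_nhdsGT_iff_exists_Ioo_subset.1 hev
  rw [mem_Ioi] at hδ
  obtain ⟨m, hm, hmf⟩ := hmin (δ / 2) (half_pos hδ)
  set η := δ / 2 with hη
  have hη0 : 0 < η := half_pos hδ
  have hηδ : η < δ := half_lt_self hδ
  set T : Set ℝ := {x : ℝ | a + η ≤ x ∧ (x : EReal) < b} with hTdef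
  have hT : MeasurableSet T := measurableSet_Ici.inter hopen.measurableSet
  have hTS : T ⊆ S := fun x hx => ⟨by linarith [hx.1], hx.2⟩
  have hηb : ((a + η : ℝ) : EReal) < b := (hsub ⟨hη0, hηδ⟩).2.2
  have hIcoS : Ico a (a + η) ⊆ S := fun x hx =>
    ⟨hx.1, (EReal.coe_lt_coe_iff.2 hx.2).trans hηb⟩
  have hunion : S = Ico a (a + η) ∪ T := by
    refine Subset.antisymm (fun x hx => ?_) (union_subset hIcoS hTS)
    rcases lt_or_ge x (a + η) with h | h
    · exact Or.inl ⟨hx.1, h⟩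
    · exact Or.inr ⟨h, hx.2⟩
  have hdisj : Disjoint (Ico a (a + η)) T :=
    Set.disjoint_left.2 fun x hx hx' => absurd hx.2 (not_lt.2 hx'.1)
  have hexp : ∀ lam x : ℝ, Real.exp (-lam * (f x - f a)) * g x
      = Real.exp (lam * f a) * (Real.exp (-lam * f x) * g x) := by
    intro lam x
    rw [← mul_assoc, ← Real.exp_add]
    ring_nf
  have hint : ∀ lam, Λ ≤ lam →
      IntegrableOn (fun x => Real.exp (-lam * (f x - f a)) * g x) S := by
    intro lam hlam
    simp only [hexp]
    exact (hΛ lam hlam).const_mul _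
  have hpre : (fun u : ℝ => a + u) ⁻¹' Ioo a (a + η) = Ioo 0 η := by simp
  have hmp := measurePreserving_add_left (volume : Measure ℝ) a
  have hemb := measurableEmbedding_addLeft a
  have hnear := tendsto_rpow_mul_setIntegral_exp_neg_mul hα hβ ha₀ hb₀ hη0 hφ hγ
    (fun u hu => (hsub ⟨hu.1, hu.2.trans hηδ⟩).1)
    (fun u hu => (hsub ⟨hu.1, hu.2.trans hηδ⟩).2.1)
    (by
      filter_upwards [eventually_ge_atTop Λ] with lam hlam
      rw [← hpre]
      exact (hmp.integrableOn_comp_preimage hemb).2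
        ((hint lam hlam).mono_set (Ioo_subset_Ico_self.trans hIcoS)))
  have hfar := tendsto_rpow_mul_setIntegral_exp_neg_mul_zero (φ := fun x => f x - f a)
    (β / α) hT (sub_pos.2 hm) (fun x hx => sub_le_sub_right (hmf x hx.1 hx.2) _)
    ((hint Λ le_rfl).mono_set hTS)
  have hK : Real.Gamma (β / α) * (b₀ / (α * a₀ ^ (β / α))) ≠ 0 := by
    have := Real.Gamma_pos_of_pos (div_pos hβ hα)
    positivity
  have hsum := (hnear.add hfar).div_const (Real.Gamma (β / α) * (b₀ / (α * a₀ ^ (β / α))))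
  rw [add_zero, div_self hK] at hsum
  refine hsum.congr' ?_
  filter_upwards [eventually_ge_atTop Λ, eventually_gt_atTop 0] with lam hlam hpos
  have hI : Real.exp (lam * f a) * ∫ x in S, Real.exp (-lam * f x) * g x
      = (∫ u in Ioo 0 η, Real.exp (-lam * (f (a + u) - f a)) * g (a + u))
        + ∫ x in T, Real.exp (-lam * (f x - f a)) * g x := by
    rw [← integral_const_mul]
    simp only [← hexp]
    rw [hunion, setIntegral_union hdisj hT ((hint lam hlam).mono_set hIcoS)
      ((hint lam hlam).mono_set hTS), integral_Ico_eq_integral_Ioo, ← hpre]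
    congr 1
    exact (hmp.setIntegral_preimage_emb hemb
      (fun x => Real.exp (-lam * (f x - f a)) * g x) (Ioo a (a + η))).symm
  rw [← mul_add, ← hI, Real.rpow_neg hpos.le, neg_mul lam, Real.exp_neg]
  have := Real.rpow_pos_of_pos hpos (β / α)
  rw [mul_assoc _ (Real.exp (lam * f a))⁻¹, ← mul_inv, ← div_eq_mul_inv, div_div_eq_mul_div]
  ring
end

section
/- (Gao–Lee implied-variance transfer at fixed out-of-the-money log-strike.) Fix k > 1 and write x = log k > 0. Let c : (0,τ₀) → (0,∞) and suppose there exist constants J > 0 and α ∈ ℝ such that −log c(τ) = J/τ − (3/2)·log τ + α + o(1) as τ → 0⁺. Suppose also that for each τ ∈ (0,τ₀) there is v(τ) > 0 with c(τ) = Φ(d₁(τ)) − k·Φ(d₂(τ)), where d₁(τ) = (−x + v(τ)²τ/2)/(v(τ)√τ) and d₂(τ) = d₁(τ) − v(τ)√τ. Then v(τ)² = x²/(2J) − (x²/(4J²))·(x + log(x²/(16π)) + 2α − 3·log J)·τ + o(τ) as τ → 0⁺. -/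
/-- The standard normal cumulative distribution function. -/
noncomputable def stdNormalCDF (x : ℝ) : ℝ :=
  ∫ t in Set.Iic x, Real.exp (-t ^ 2 / 2) / Real.sqrt (2 * Real.pi)

section

open Filter Topology Real MeasureTheory

theorem integrable_stdNormalDensity :
    Integrable fun t : ℝ => exp (-t ^ 2 / 2) / √(2 * π) := by
  refine ((integrable_exp_neg_mul_sq (b := 1 / 2) (by norm_num)).div_const (√(2 * π))).congr
    (Eventually.of_forall fun t => ?_)
  ring_nf

theorem stdNormalCDF_eq (y : ℝ) :
    stdNormalCDF y =
      stdNormalCDF 0 + ∫ t in (0 : ℝ)..y, exp (-t ^ 2 / 2) / √(2 * π) := by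
  rw [← intervalIntegral.integral_Iic_sub_Iic integrable_stdNormalDensity.integrableOn
    integrable_stdNormalDensity.integrableOn]
  simp only [stdNormalCDF]
  ring

theorem hasDerivAt_stdNormalCDF (y : ℝ) :
    HasDerivAt stdNormalCDF (exp (-y ^ 2 / 2) / √(2 * π)) y := by
  have hc : Continuous fun t : ℝ => exp (-t ^ 2 / 2) / √(2 * π) := by fun_prop
  rw [funext stdNormalCDF_eq]
  exact (hc.integral_hasStrictDerivAt 0 y).hasDerivAt.const_add _

theorem tendsto_stdNormalCDF_atBot : Tendsto stdNormalCDF atBot (𝓝 0) := by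
  have h := intervalIntegral_tendsto_integral_Iic (0 : ℝ)
    integrable_stdNormalDensity.integrableOn tendsto_id
  have h2 := h.const_sub (stdNormalCDF 0)
  simp only [id] at h2
  rw [show stdNormalCDF 0 - ∫ t in Set.Iic (0 : ℝ), exp (-t ^ 2 / 2) / √(2 * π) = 0 from
    sub_self _] at h2
  refine h2.congr fun y => ?_
  rw [stdNormalCDF_eq y, intervalIntegral.integral_symm]
  ring

/-- The undiscounted Black–Scholes call price with unit forward, log-strike `x` and total
volatility `s`. -/
noncomputable def blackCall (x s : ℝ) : ℝ :=
  stdNormalCDF (-x / s + s / 2) - exp x * stdNormalCDF (-x / s - s / 2)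

theorem hasDerivAt_blackCall (x : ℝ) {s : ℝ} (hs : s ≠ 0) :
    HasDerivAt (blackCall x) (exp (-(-x / s + s / 2) ^ 2 / 2) / √(2 * π)) s := by
  have h0 : HasDerivAt (fun s : ℝ => -x / s) (x / s ^ 2) s := by
    have := (hasDerivAt_inv hs).const_mul (-x)
    simp only [← div_eq_mul_inv] at this
    exact this.congr_deriv (by ring)
  have hh : HasDerivAt (fun s : ℝ => s / 2) (1 / 2) s := (hasDerivAt_id s).div_const 2
  have h1 := (hasDerivAt_stdNormalCDF _).comp s (h0.add hh)
  have h2 := ((hasDerivAt_stdNormalCDF _).comp s (h0.sub hh)).const_mul (exp x)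
  have key : exp x * exp (-(-x / s - s / 2) ^ 2 / 2) = exp (-(-x / s + s / 2) ^ 2 / 2) := by
    rw [← exp_add]
    congr 1
    field_simp
    ring
  refine (h1.sub h2).congr_deriv ?_
  simp only [Pi.add_apply, Pi.sub_apply]
  rw [← key]
  ring

theorem strictMonoOn_blackCall (x : ℝ) : StrictMonoOn (blackCall x) (Set.Ioi 0) := by
  refine strictMonoOn_of_deriv_pos (convex_Ioi 0)
    (fun s hs => (hasDerivAt_blackCall x (ne_of_gt hs)).continuousAt.continuousWithinAt)
    fun s hs => ?_
  rw [interior_Ioi] at hs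
  rw [(hasDerivAt_blackCall x (ne_of_gt hs)).deriv]
  positivity

theorem tendsto_neg_div_nhdsGT_zero {x : ℝ} (hx : 0 < x) :
    Tendsto (fun s : ℝ => -x / s) (𝓝[>] 0) atBot := by
  simpa only [div_eq_mul_inv] using
    tendsto_inv_nhdsGT_zero.const_mul_atTop_of_neg (neg_lt_zero.2 hx)

theorem tendsto_half_nhdsGT_zero : Tendsto (fun s : ℝ => s / 2) (𝓝[>] 0) (𝓝 0) := by
  have : Tendsto (fun s : ℝ => s / 2) (𝓝 0) (𝓝 (0 / 2)) := tendsto_id.div_const 2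
  rw [zero_div] at this
  exact this.mono_left nhdsWithin_le_nhds

theorem tendsto_blackCall_nhdsGT_zero {x : ℝ} (hx : 0 < x) :
    Tendsto (blackCall x) (𝓝[>] 0) (𝓝 0) := by
  have h1 := tendsto_stdNormalCDF_atBot.comp
    ((tendsto_neg_div_nhdsGT_zero hx).atBot_add tendsto_half_nhdsGT_zero)
  have h2 := tendsto_stdNormalCDF_atBot.comp
    ((tendsto_neg_div_nhdsGT_zero hx).atBot_add tendsto_half_nhdsGT_zero.neg)
  have h := h1.sub (h2.const_mul (exp x))
  rw [mul_zero, sub_zero] at h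
  exact h.congr fun s => by simp only [blackCall, Function.comp_apply, sub_eq_add_neg]

theorem blackCall_pos {x s : ℝ} (hx : 0 < x) (hs : 0 < s) : 0 < blackCall x s := by
  have hs2 : 0 < s / 2 := by positivity
  have h : 0 ≤ blackCall x (s / 2) := by
    refine le_of_tendsto (tendsto_blackCall_nhdsGT_zero hx) ?_
    filter_upwards [Ioo_mem_nhdsGT hs2] with u hu
    exact (strictMonoOn_blackCall x hu.1 hs2 hu.2).le
  exact h.trans_lt (strictMonoOn_blackCall x hs2 hs (half_lt_self hs))

/-- Total volatilities tend to zero as soon as the corresponding call prices do. -/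
theorem tendsto_zero_of_tendsto_blackCall {ι : Type*} {l : Filter ι} {x : ℝ} (hx : 0 < x)
    {s : ι → ℝ} (hs : ∀ᶠ i in l, 0 < s i) (h : Tendsto (fun i => blackCall x (s i)) l (𝓝 0)) :
    Tendsto s l (𝓝[>] 0) := by
  refine tendsto_nhdsWithin_iff.2 ⟨?_, hs⟩
  refine tendsto_order.2 ⟨fun a ha => hs.mono fun i hi => ha.trans hi, fun a ha => ?_⟩
  filter_upwards [hs, h.eventually_lt_const (blackCall_pos hx ha)] with i hi hlt
  exact ((strictMonoOn_blackCall x).lt_iff_lt hi ha).1 hlt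

/-- Leading-order asymptotics of the call price for small total volatility. -/
theorem tendsto_blackCall_div {x : ℝ} (hx : 0 < x) :
    Tendsto (fun s => blackCall x s / (s ^ 3 / x ^ 2 * exp (-x ^ 2 / (2 * s ^ 2)))) (𝓝[>] 0)
      (𝓝 (exp (x / 2) / √(2 * π))) := by
  have hderiv : ∀ s : ℝ, 0 < s → HasDerivAt
      (fun s : ℝ => s ^ 3 / x ^ 2 * exp (-x ^ 2 / (2 * s ^ 2)))
      ((1 + 3 * s ^ 2 / x ^ 2) * exp (-x ^ 2 / (2 * s ^ 2))) s := by
    intro s hs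
    have h1 : HasDerivAt (fun s : ℝ => s ^ 3 / x ^ 2) (3 * s ^ 2 / x ^ 2) s := by
      simpa using (hasDerivAt_pow 3 s).div_const (x ^ 2)
    have h2 : HasDerivAt (fun s : ℝ => -x ^ 2 / (2 * s ^ 2)) (x ^ 2 / s ^ 3) s := by
      have := ((hasDerivAt_const s (-x ^ 2)).div ((hasDerivAt_pow 2 s).const_mul 2)
        (by positivity))
      refine this.congr_deriv ?_
      simp
      field_simp
    refine (h1.mul h2.exp).congr_deriv ?_
    field_simp
    ring
  have hpow : ∀ n : ℕ, n ≠ 0 → Tendsto (fun s : ℝ => s ^ n) (𝓝[>] 0) (𝓝 0) := fun n hn => by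
    have : Tendsto (fun s : ℝ => s ^ n) (𝓝 0) (𝓝 (0 ^ n)) := (continuous_pow n).tendsto 0
    rw [zero_pow hn] at this
    exact this.mono_left nhdsWithin_le_nhds
  refine HasDerivAt.lhopital_zero_nhdsGT
    (f' := fun s => exp (-(-x / s + s / 2) ^ 2 / 2) / √(2 * π))
    (g' := fun s => (1 + 3 * s ^ 2 / x ^ 2) * exp (-x ^ 2 / (2 * s ^ 2))) ?_ ?_ ?_
    (tendsto_blackCall_nhdsGT_zero hx) ?_ ?_
  · filter_upwards [self_mem_nhdsWithin] with s hs using hasDerivAt_blackCall x (ne_of_gt hs)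
  · filter_upwards [self_mem_nhdsWithin] with s hs using hderiv s hs
  · filter_upwards [self_mem_nhdsWithin] with s hs
    positivity
  · have h3 := (hpow 3 (by norm_num)).div_const (x ^ 2)
    rw [zero_div] at h3
    refine squeeze_zero' ?_ ?_ h3
    · filter_upwards [self_mem_nhdsWithin] with s (hs : 0 < s)
      positivity
    · filter_upwards [self_mem_nhdsWithin] with s (hs : 0 < s)
      refine mul_le_of_le_one_right (by positivity) (exp_le_one_iff.2 ?_)
      rw [neg_div]
      exact neg_nonpos.2 (by positivity)
  · have h2 := hpow 2 (by norm_num)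
    have hnum : Tendsto (fun s : ℝ => exp (x / 2 - s ^ 2 / 8) / √(2 * π)) (𝓝[>] 0)
        (𝓝 (exp (x / 2 - 0 / 8) / √(2 * π))) :=
      ((continuous_exp.tendsto _).comp ((h2.div_const 8).const_sub (x / 2))).div_const _
    have hden : Tendsto (fun s : ℝ => 1 + 3 * s ^ 2 / x ^ 2) (𝓝[>] 0)
        (𝓝 (1 + 3 * 0 / x ^ 2)) := ((h2.const_mul 3).div_const _).const_add 1
    have := hnum.div hden (by simp)
    simp only [zero_div, sub_zero, mul_zero, add_zero, div_one] at this
    refine this.congr' ?_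
    filter_upwards [self_mem_nhdsWithin] with s (hs : 0 < s)
    have key : exp (-(-x / s + s / 2) ^ 2 / 2)
        = exp (x / 2 - s ^ 2 / 8) * exp (-x ^ 2 / (2 * s ^ 2)) := by
      rw [← exp_add]
      congr 1
      field_simp
      ring
    simp only [Pi.div_apply]
    rw [key]
    field_simp

theorem tendsto_log_blackCall {x : ℝ} (hx : 0 < x) :
    Tendsto (fun s => -log (blackCall x s) - (x ^ 2 / (2 * s ^ 2) - 3 * log s)) (𝓝[>] 0)
      (𝓝 (2 * log x + log (2 * π) / 2 - x / 2)) := by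
  have h := ((continuousAt_log (by positivity)).tendsto.comp (tendsto_blackCall_div hx)).neg
  have h' := h.add_const (2 * log x)
  rw [log_div (by positivity) (by positivity), log_exp, log_sqrt (by positivity)] at h'
  rw [show 2 * log x + log (2 * π) / 2 - x / 2 = -(x / 2 - log (2 * π) / 2) + 2 * log x by ring]
  refine h'.congr' ?_
  filter_upwards [self_mem_nhdsWithin] with s (hs : 0 < s)
  have hp := blackCall_pos hx hs
  simp only [Function.comp_def]
  rw [log_div hp.ne' (by positivity), log_mul (by positivity) (by positivity), log_exp,
    log_div (by positivity) (by positivity), log_pow, log_pow]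
  push_cast
  ring

theorem tendsto_mul_log_nhdsGT_zero : Tendsto (fun t : ℝ => t * log t) (𝓝[>] 0) (𝓝 0) := by
  simpa using (continuous_mul_log.tendsto 0).mono_left (nhdsWithin_le_nhds (s := Set.Ioi 0))

/-- If the total volatility `s τ → 0` satisfies
`x² / (2 s²) - 3 log s = J / τ - (3 / 2) log τ + β + o(1)`, then `s² / τ → x² / (2 J)`. -/
theorem tendsto_sq_div {x J β : ℝ} (hJ : 0 < J) {s : ℝ → ℝ} (hs : Tendsto s (𝓝[>] 0) (𝓝[>] 0))
    (h : Tendsto (fun τ => x ^ 2 / (2 * s τ ^ 2) - 3 * log (s τ) - (J / τ - 3 / 2 * log τ))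
      (𝓝[>] 0) (𝓝 β)) :
    Tendsto (fun τ => s τ ^ 2 / τ) (𝓝[>] 0) (𝓝 (x ^ 2 / (2 * J))) := by
  have hspos : ∀ᶠ τ in 𝓝[>] (0 : ℝ), 0 < s τ := hs.eventually self_mem_nhdsWithin
  have hτ : Tendsto (fun τ : ℝ => τ) (𝓝[>] 0) (𝓝 0) := nhdsWithin_le_nhds
  have hs0 : Tendsto s (𝓝[>] 0) (𝓝 0) := hs.mono_right nhdsWithin_le_nhds
  have hnum : Tendsto (fun τ => x ^ 2 / 2 - 3 * (s τ * (s τ * log (s τ)))) (𝓝[>] 0)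
      (𝓝 (x ^ 2 / 2)) := by
    simpa using ((hs0.mul (tendsto_mul_log_nhdsGT_zero.comp hs)).const_mul 3).const_sub (x ^ 2 / 2)
  have hden : Tendsto (fun τ => J - 3 / 2 * (τ * log τ) +
      τ * (x ^ 2 / (2 * s τ ^ 2) - 3 * log (s τ) - (J / τ - 3 / 2 * log τ))) (𝓝[>] 0) (𝓝 J) := by
    simpa using ((tendsto_mul_log_nhdsGT_zero.const_mul (3 / 2)).const_sub J).add (hτ.mul h)
  have hq := hnum.div hden hJ.ne'
  rw [div_div] at hq
  refine hq.congr' ?_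
  filter_upwards [hspos, self_mem_nhdsWithin, hden.eventually_ne hJ.ne'] with τ hsτ hτ hne
  have hτ' : τ ≠ 0 := ne_of_gt hτ
  rw [Pi.div_apply, div_eq_div_iff hne hτ']
  field_simp
  ring

/-- First-order refinement of `tendsto_sq_div`. -/
theorem tendsto_sq_div_sub_div {x J β : ℝ} (hx : 0 < x) (hJ : 0 < J) {s : ℝ → ℝ}
    (hs : Tendsto s (𝓝[>] 0) (𝓝[>] 0))
    (h : Tendsto (fun τ => x ^ 2 / (2 * s τ ^ 2) - 3 * log (s τ) - (J / τ - 3 / 2 * log τ))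
      (𝓝[>] 0) (𝓝 β)) :
    Tendsto (fun τ => (s τ ^ 2 / τ - x ^ 2 / (2 * J)) / τ) (𝓝[>] 0)
      (𝓝 (-(x ^ 2 / (2 * J ^ 2)) * (β + 3 / 2 * log (x ^ 2 / (2 * J))))) := by
  have hspos : ∀ᶠ τ in 𝓝[>] (0 : ℝ), 0 < s τ := hs.eventually self_mem_nhdsWithin
  have hL := tendsto_sq_div hJ hs h
  have hlog := (continuousAt_log (show x ^ 2 / (2 * J) ≠ 0 by positivity)).tendsto.comp hL
  have hmain := ((h.add (hlog.const_mul (3 / 2))).mul (hL.div_const J)).neg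
  rw [show -(x ^ 2 / (2 * J ^ 2)) * (β + 3 / 2 * log (x ^ 2 / (2 * J)))
    = -((β + 3 / 2 * log (x ^ 2 / (2 * J))) * (x ^ 2 / (2 * J) / J)) by field_simp]
  refine hmain.congr' ?_
  filter_upwards [hspos, self_mem_nhdsWithin] with τ hsτ (hτ : 0 < τ)
  simp only [Function.comp_def]
  rw [log_div (by positivity) hτ.ne', log_pow]
  push_cast
  field_simp
  ring

theorem tendsto_zero_of_neg_log {c : ℝ → ℝ} {J α : ℝ} (hJ : 0 < J)
    (hc : ∀ᶠ τ in 𝓝[>] (0 : ℝ), 0 < c τ)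
    (h : Tendsto (fun τ => -log (c τ) - (J / τ - 3 / 2 * log τ + α)) (𝓝[>] 0) (𝓝 0)) :
    Tendsto c (𝓝[>] 0) (𝓝 0) := by
  have hτ : Tendsto (fun τ : ℝ => τ) (𝓝[>] 0) (𝓝 0) := nhdsWithin_le_nhds
  have h1 : Tendsto (fun τ => J - 3 / 2 * (τ * log τ) + τ * (α +
      (-log (c τ) - (J / τ - 3 / 2 * log τ + α)))) (𝓝[>] 0) (𝓝 J) := by
    simpa using ((tendsto_mul_log_nhdsGT_zero.const_mul (3 / 2)).const_sub J).add
      (hτ.mul (h.const_add α))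
  have h2 := tendsto_exp_neg_atTop_nhds_zero.comp
    (h1.pos_mul_atTop hJ (tendsto_inv_nhdsGT_zero (𝕜 := ℝ)))
  refine h2.congr' ?_
  filter_upwards [hc, self_mem_nhdsWithin] with τ hcτ (hτ : 0 < τ)
  rw [Function.comp_apply]
  convert exp_log hcτ using 2
  field_simp
  ring

end

open Filter in
/-- Gao–Lee implied-variance transfer at a fixed out-of-the-money log-strike
`x = log k > 0`: if `−log c(τ) = J/τ − (3/2)log τ + α + o(1)` and `v(τ)` is the
Black–Scholes implied total-volatility-per-√τ of `c(τ)` at strike `k`, then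
`v(τ)² = x²/(2J) − (x²/(4J²))(x + log(x²/(16π)) + 2α − 3 log J)·τ + o(τ)`. -/
theorem gao_lee_transfer (k : ℝ) (hk : 1 < k) (τ₀ : ℝ) (hτ₀ : 0 < τ₀)
    (c v : ℝ → ℝ) (J α : ℝ) (hJ : 0 < J)
    (hcpos : ∀ τ : ℝ, 0 < τ → τ < τ₀ → 0 < c τ)
    (hlog : Tendsto
      (fun τ : ℝ => -Real.log (c τ) - (J / τ - (3/2) * Real.log τ + α))
      (nhdsWithin 0 (Set.Ioi 0)) (nhds 0))
    (hv : ∀ τ : ℝ, 0 < τ → τ < τ₀ → 0 < v τ ∧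
      c τ = stdNormalCDF ((-Real.log k + (v τ) ^ 2 * τ / 2) / (v τ * Real.sqrt τ))
        - k * stdNormalCDF
            ((-Real.log k + (v τ) ^ 2 * τ / 2) / (v τ * Real.sqrt τ)
              - v τ * Real.sqrt τ)) :
    Tendsto (fun τ : ℝ =>
        ((v τ) ^ 2 - ((Real.log k) ^ 2 / (2 * J)
          - (Real.log k) ^ 2 / (4 * J ^ 2) *
            (Real.log k + Real.log ((Real.log k) ^ 2 / (16 * Real.pi)) + 2 * α
              - 3 * Real.log J) * τ)) / τ)
      (nhdsWithin 0 (Set.Ioi 0)) (nhds 0) := by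
  have hx : 0 < Real.log k := Real.log_pos hk
  have hτ : ∀ᶠ τ in nhdsWithin (0 : ℝ) (Set.Ioi 0), 0 < τ ∧ τ < τ₀ := Ioo_mem_nhdsGT hτ₀
  have hspos : ∀ᶠ τ in nhdsWithin (0 : ℝ) (Set.Ioi 0), 0 < v τ * Real.sqrt τ := by
    filter_upwards [hτ] with τ h
    exact mul_pos (hv τ h.1 h.2).1 (Real.sqrt_pos.2 h.1)
  have hcall : c =ᶠ[nhdsWithin 0 (Set.Ioi 0)]
      fun τ => blackCall (Real.log k) (v τ * Real.sqrt τ) := by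
    filter_upwards [hτ] with τ h
    obtain ⟨hvτ, hcτ⟩ := hv τ h.1 h.2
    have hsq : 0 < Real.sqrt τ := Real.sqrt_pos.2 h.1
    have hd : (-Real.log k + (v τ) ^ 2 * τ / 2) / (v τ * Real.sqrt τ)
        = -Real.log k / (v τ * Real.sqrt τ) + v τ * Real.sqrt τ / 2 := by
      field_simp
      rw [Real.sq_sqrt h.1.le]
    rw [hcτ, hd, blackCall, Real.exp_log (by linarith)]
    ring_nf
  have hc0 := tendsto_zero_of_neg_log hJ (hτ.mono fun τ h => hcpos τ h.1 h.2) hlog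
  have hs := tendsto_zero_of_tendsto_blackCall hx hspos (hc0.congr' hcall)
  have hβ := (hlog.sub ((tendsto_log_blackCall hx).comp hs)).const_add α
  have key := tendsto_sq_div_sub_div (J := J) hx hJ hs (hβ.congr' (by
    filter_upwards [hcall] with τ h
    simp only [Function.comp_apply]
    rw [h]
    ring))
  have hconst : Real.log ((Real.log k) ^ 2 / (16 * Real.pi))
      = 2 * Real.log (Real.log k) - (3 * Real.log 2 + Real.log (2 * Real.pi)) := by
    rw [Real.log_div (by positivity) (by positivity), Real.log_pow,
      show (16 : ℝ) * Real.pi = 2 ^ 3 * (2 * Real.pi) by ring,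
      Real.log_mul (by positivity) (by positivity), Real.log_pow]
    norm_num
  have key' := key.add_const ((Real.log k) ^ 2 / (4 * J ^ 2) *
    (Real.log k + Real.log ((Real.log k) ^ 2 / (16 * Real.pi)) + 2 * α - 3 * Real.log J))
  rw [hconst, Real.log_div (by positivity) (by positivity), Real.log_pow,
    Real.log_mul (x := 2) (y := J) (by positivity) (by positivity)] at key'
  rw [hconst]
  convert key'.congr' ?_ using 2
  · push_cast
    ring
  · filter_upwards [hτ] with τ h
    have hne : τ ≠ 0 := h.1.ne'
    rw [mul_pow, Real.sq_sqrt h.1.le]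
    field_simp
    ring
end

section
/- Define v(ρ) = (1/ρ³)·(ρe^{2ρ} − (3/2)e^{2ρ} + 2e^{ρ} − 1/2) for ρ ≠ 0. Then as ρ → 0, (ρ²/(e^{ρ} − 1)²)·v(ρ) = 1/3 + ρ/12 + ρ²/180 + O(ρ³); that is, ρ ↦ ((ρ²/(e^{ρ}−1)²)·v(ρ) − 1/3 − ρ/12 − ρ²/180)/ρ³ is bounded in a punctured neighborhood of ρ = 0. -/
/-- `v(ρ) = (1/ρ³)(ρ e^{2ρ} − (3/2)e^{2ρ} + 2e^ρ − 1/2)`. -/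
noncomputable def asianATMvar (ρ : ℝ) : ℝ :=
  (1 / ρ ^ 3) * (ρ * Real.exp (2 * ρ) - (3/2) * Real.exp (2 * ρ)
    + 2 * Real.exp ρ - 1/2)

/-- The degree-five Taylor polynomial of `exp` at `0`. -/
noncomputable def expTaylorFive (x : ℝ) : ℝ :=
  1 + x + x ^ 2 / 2 + x ^ 3 / 6 + x ^ 4 / 24 + x ^ 5 / 120

/-- If `exp x = expTaylorFive x + x ^ 6 * s`, then `x ^ 6 * asianRemainder x s` is the numerator of
the remainder in the expansion of the squared at-the-money Asian implied volatility. -/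
noncomputable def asianRemainder (x s : ℝ) : ℝ :=
  (-1/1920) * x ^ 2 + (-47/129600) * x ^ 3 + (-73/518400) * x ^ 4 + (-19/518400) * x ^ 5
    + (-1/103680) * x ^ 6 + (-1/2592000) * x ^ 7
    + s * (2 * (x - 3/2 - x * (1/3 + x/12 + x ^ 2/180)) * expTaylorFive x
      + (2 + 2 * x * (1/3 + x/12 + x ^ 2/180))
      + (x - 3/2 - x * (1/3 + x/12 + x ^ 2/180)) * (x ^ 6 * s))

lemma asian_numerator_eq (x s : ℝ) :
    x * (expTaylorFive x + x ^ 6 * s) ^ 2 - (3/2) * (expTaylorFive x + x ^ 6 * s) ^ 2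
      + 2 * (expTaylorFive x + x ^ 6 * s) - 1/2
      - x * (1/3 + x/12 + x ^ 2/180) * (expTaylorFive x + x ^ 6 * s - 1) ^ 2
      = x ^ 6 * asianRemainder x s := by
  unfold asianRemainder expTaylorFive
  ring

lemma exists_abs_asianRemainder_le :
    ∃ M > (0:ℝ), ∀ x s : ℝ, |x| ≤ 1 → |s| ≤ 1 → |asianRemainder x s| ≤ M := by
  have hc : Continuous fun p : ℝ × ℝ => asianRemainder p.1 p.2 := by
    unfold asianRemainder expTaylorFive
    fun_prop
  obtain ⟨M, hM⟩ := ((isCompact_Icc (a := (-1:ℝ)) (b := 1)).prod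
    (isCompact_Icc (a := (-1:ℝ)) (b := 1))).exists_bound_of_continuousOn hc.continuousOn
  refine ⟨max M 1, by positivity, fun x s hx hs => ?_⟩
  exact (hM (x, s) ⟨abs_le.mp hx, abs_le.mp hs⟩).trans (le_max_left _ _)

lemma exists_exp_eq_expTaylorFive_add {x : ℝ} (hx : x ≠ 0) (hx1 : |x| ≤ 1) :
    ∃ s : ℝ, |s| ≤ 1 ∧ Real.exp x = expTaylorFive x + x ^ 6 * s := by
  have h := Real.exp_bound hx1 (n := 6) (by norm_num)
  have hT : ∑ m ∈ Finset.range 6, x ^ m / (m.factorial : ℝ) = expTaylorFive x := by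
    simp [Finset.sum_range_succ, Nat.factorial, expTaylorFive]
  rw [hT] at h
  have hpos : 0 < |x| ^ 6 := by positivity
  refine ⟨(Real.exp x - expTaylorFive x) / x ^ 6, ?_, by field_simp; ring⟩
  rw [abs_div, abs_pow, div_le_one hpos]
  refine h.trans (mul_le_of_le_one_right hpos.le ?_)
  norm_num [Nat.factorial]

lemma sq_div_four_le_exp_sub_one_sq {x : ℝ} (hx : |x| ≤ 1/2) :
    x ^ 2 / 4 ≤ (Real.exp x - 1) ^ 2 := by
  have h := Real.abs_exp_sub_one_sub_id_le (x := x) (by linarith)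
  have h1 : |x| ≤ |Real.exp x - 1| + |Real.exp x - 1 - x| := by
    simpa using abs_sub (Real.exp x - 1) (Real.exp x - 1 - x)
  have h2 : |x| / 2 ≤ |Real.exp x - 1| := by
    nlinarith [abs_nonneg x, sq_abs x]
  rw [← sq_abs x, ← sq_abs (Real.exp x - 1)]
  nlinarith [abs_nonneg x]

/-- Small-`ρ` expansion of the squared ATM Asian implied volatility in the fixed
`ρ = rT` limit: `(ρ²/(e^ρ − 1)²)·v(ρ) = 1/3 + ρ/12 + ρ²/180 + O(ρ³)`. -/
theorem asianATMvar_taylor :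
    ∃ C > (0:ℝ), ∃ δ > (0:ℝ), ∀ ρ : ℝ, ρ ≠ 0 → |ρ| < δ →
      |ρ ^ 2 / (Real.exp ρ - 1) ^ 2 * asianATMvar ρ - 1/3 - ρ/12 - ρ ^ 2/180|
        ≤ C * |ρ| ^ 3 := by
  obtain ⟨M, hM, hbound⟩ := exists_abs_asianRemainder_le
  refine ⟨4 * M, by positivity, 1/2, by norm_num, fun ρ hρ hlt => ?_⟩
  obtain ⟨s, hs, hexp⟩ := exists_exp_eq_expTaylorFive_add hρ (by linarith)
  have hden := sq_div_four_le_exp_sub_one_sq hlt.le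
  have habs : 0 < |ρ| := abs_pos.mpr hρ
  have hpos : 0 < (Real.exp ρ - 1) ^ 2 := lt_of_lt_of_le (by positivity) hden
  have hne : Real.exp ρ - 1 ≠ 0 := fun h => by simp [h] at hpos
  have hnum := asian_numerator_eq ρ s
  rw [← hexp] at hnum
  have hsq : Real.exp (2 * ρ) = Real.exp ρ ^ 2 := by
    rw [two_mul, Real.exp_add, sq]
  have key : ρ ^ 2 / (Real.exp ρ - 1) ^ 2 * asianATMvar ρ - 1/3 - ρ/12 - ρ ^ 2/180
      = ρ ^ 5 * asianRemainder ρ s / (Real.exp ρ - 1) ^ 2 := by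
    rw [eq_div_iff hpos.ne']
    apply mul_left_cancel₀ hρ
    rw [← mul_assoc, ← mul_assoc, ← pow_succ', ← hnum, asianATMvar, hsq]
    field_simp
    ring
  rw [key, abs_div, abs_mul, abs_pow, abs_of_pos hpos, div_le_iff₀ hpos]
  calc |ρ| ^ 5 * |asianRemainder ρ s| ≤ |ρ| ^ 5 * M := by
        gcongr
        exact hbound ρ s (by linarith) hs
    _ = 4 * M * |ρ| ^ 3 * (ρ ^ 2 / 4) := by rw [← sq_abs ρ]; ring
    _ ≤ 4 * M * |ρ| ^ 3 * (Real.exp ρ - 1) ^ 2 := by gcongr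
end
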